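/- arXiv:0806.0435 — 5 statements merged into one kernel-verified Lean document; each statement's English description precedes it below -/
import Mathlib

section
/- Let n ≥ 3 and S ⊆ [n] (so that n+1 ∉ S). Then cp_{n+1}(S) = 2·cp_n(S). -/
/-- The permutation σ of `Fin n` viewed as a word on `[n] = {1,…,n}`:
position `j` (0-indexed) carries the letter `σ(j)+1`; out-of-range positions give `0`. -/
def permToFun (n : ℕ) (σ : Equiv.Perm (Fin n)) : ℕ → ℕ :=
  fun j => if h : j < n then ((σ ⟨j, h⟩ : ℕ) + 1) else 0

/-- The circular peak set `CP(σ) = {σ(i) | σ(i-1) < σ(i) > σ(i+1)}` of a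
permutation of `[n]`, as a `Finset ℕ` of values in `{1,…,n}`. -/
def circularPeakSet (n : ℕ) (σ : Equiv.Perm (Fin n)) : Finset ℕ :=
  ((Finset.Ioo 0 (n - 1)).filter (fun j =>
    permToFun n σ (j - 1) < permToFun n σ j ∧
    permToFun n σ (j + 1) < permToFun n σ j)).image (permToFun n σ)

/-- `CPperms n S` is the set `CP_n(S)` of permutations of `[n]` with circular peak set `S`. -/
def CPperms (n : ℕ) (S : Finset ℕ) : Finset (Equiv.Perm (Fin n)) :=
  Finset.univ.filter (fun σ => circularPeakSet n σ = S)

/-- `cp n S = |CP_n(S)|`. -/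
def cp (n : ℕ) (S : Finset ℕ) : ℕ := (CPperms n S).card

def insMax (n : ℕ) (p : Fin (n+1)) (σ : Equiv.Perm (Fin n)) : Equiv.Perm (Fin (n+1)) :=
  ((finSuccEquiv' p).trans (Equiv.optionCongr σ)).trans (finSuccEquiv' (Fin.last n)).symm

lemma insMax_self (n : ℕ) (p : Fin (n+1)) (σ : Equiv.Perm (Fin n)) :
    insMax n p σ p = Fin.last n := by
  simp [insMax]

lemma insMax_succAbove (n : ℕ) (p : Fin (n+1)) (σ : Equiv.Perm (Fin n)) (i : Fin n) :
    insMax n p σ (p.succAbove i) = (σ i).castSucc := by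
  simp [insMax]

lemma insMax_inj (n : ℕ) (p : Fin (n+1)) : Function.Injective (insMax n p) := by
  intro σ τ h
  ext i
  have := congrArg (fun e => e (p.succAbove i)) h
  simp only [insMax_succAbove] at this
  rw [Fin.castSucc_injective n this]

lemma insMax_surj (n : ℕ) (p : Fin (n+1)) (τ : Equiv.Perm (Fin (n+1))) (h : τ p = Fin.last n) :
    ∃ σ, insMax n p σ = τ := by
  have hne : ∀ i, τ (p.succAbove i) ≠ Fin.last n := by
    intro i hi
    rw [← h] at hi
    exact Fin.succAbove_ne p i (τ.injective hi)
  let f : Fin n → Fin n := fun i => (τ (p.succAbove i)).castPred (hne i)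
  have hf : Function.Injective f := by
    intro i j hij
    have := Fin.castPred_inj.mp hij
    exact Fin.succAbove_right_injective (τ.injective this)
  refine ⟨Equiv.ofBijective f (Finite.injective_iff_bijective.mp hf), ?_⟩
  apply Equiv.ext
  intro x
  rcases Fin.eq_self_or_eq_succAbove p x with rfl | ⟨i, rfl⟩
  · rw [insMax_self, h]
  · rw [insMax_succAbove]; simp [f]

lemma ptf_le (n : ℕ) (σ : Equiv.Perm (Fin n)) (j : ℕ) : permToFun n σ j ≤ n := by
  unfold permToFun
  split_ifs with h
  · exact (σ ⟨j, h⟩).isLt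
  · omega

lemma ptf_last_lt (n : ℕ) (σ : Equiv.Perm (Fin n)) (j : ℕ) (h : j < n) :
    permToFun (n+1) (insMax n (Fin.last n) σ) j = permToFun n σ j := by
  have := insMax_succAbove n (Fin.last n) σ ⟨j, h⟩
  rw [Fin.succAbove_last] at this
  simp only [permToFun, h, show j < n + 1 by omega, dif_pos]
  have h2 := congrArg Fin.val this
  simpa using h2

lemma ptf_last_eq (n : ℕ) (σ : Equiv.Perm (Fin n)) :
    permToFun (n+1) (insMax n (Fin.last n) σ) n = n + 1 := by
  have h2 := congrArg Fin.val (insMax_self n (Fin.last n) σ)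
  simp only [permToFun, show n < n + 1 by omega, dif_pos]
  exact congrArg (· + 1) h2

lemma ptf_zero_succ (n : ℕ) (σ : Equiv.Perm (Fin n)) (j : ℕ) :
    permToFun (n+1) (insMax n 0 σ) (j+1) = permToFun n σ j := by
  by_cases h : j < n
  · have := insMax_succAbove n 0 σ ⟨j, h⟩
    rw [Fin.succAbove_zero] at this
    simp only [permToFun, h, show j + 1 < n + 1 by omega, dif_pos]
    have h2 := congrArg Fin.val this
    simpa using h2
  · simp [permToFun, h]

lemma ptf_zero_zero (n : ℕ) (σ : Equiv.Perm (Fin n)) :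
    permToFun (n+1) (insMax n 0 σ) 0 = n + 1 := by
  have h2 := congrArg Fin.val (insMax_self n 0 σ)
  simp only [permToFun, show 0 < n + 1 by omega, dif_pos]
  simpa using h2

lemma mem_cps (n : ℕ) (σ : Equiv.Perm (Fin n)) (v : ℕ) : v ∈ circularPeakSet n σ ↔
    ∃ j, j + 2 < n ∧ permToFun n σ j < permToFun n σ (j+1) ∧
      permToFun n σ (j+2) < permToFun n σ (j+1) ∧ permToFun n σ (j+1) = v := by
  simp only [circularPeakSet, Finset.mem_image, Finset.mem_filter, Finset.mem_Ioo]
  constructor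
  · rintro ⟨j, ⟨⟨h1, h2⟩, h3, h4⟩, h5⟩
    obtain ⟨k, rfl⟩ : ∃ k, j = k + 1 := ⟨j - 1, by omega⟩
    exact ⟨k, by omega, h3, h4, h5⟩
  · rintro ⟨j, h1, h2, h3, h4⟩
    exact ⟨j+1, ⟨⟨by omega, by omega⟩, h2, h3⟩, h4⟩

lemma cps_last (n : ℕ) (σ : Equiv.Perm (Fin n)) :
    circularPeakSet (n+1) (insMax n (Fin.last n) σ) = circularPeakSet n σ := by
  ext v
  rw [mem_cps, mem_cps]
  constructor
  · rintro ⟨j, h1, h2, h3, h4⟩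
    by_cases hj : j + 2 < n
    · rw [ptf_last_lt _ _ _ (by omega), ptf_last_lt _ _ _ (by omega)] at h2 h3
      rw [ptf_last_lt _ _ _ (by omega)] at h4
      exact ⟨j, hj, h2, h3, h4⟩
    · obtain rfl : n = j + 2 := by omega
      rw [ptf_last_eq, ptf_last_lt _ _ _ (by omega)] at h3
      have := ptf_le _ σ (j+1)
      omega
  · rintro ⟨j, h1, h2, h3, h4⟩
    refine ⟨j, by omega, ?_⟩
    rw [ptf_last_lt _ _ _ (by omega), ptf_last_lt _ _ _ (by omega), ptf_last_lt _ _ _ (by omega)]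
    exact ⟨h2, h3, h4⟩

lemma cps_zero (n : ℕ) (σ : Equiv.Perm (Fin n)) :
    circularPeakSet (n+1) (insMax n 0 σ) = circularPeakSet n σ := by
  ext v
  rw [mem_cps, mem_cps]
  constructor
  · rintro ⟨j, h1, h2, h3, h4⟩
    rcases j with _ | j
    · rw [ptf_zero_zero, ptf_zero_succ] at h2
      have := ptf_le _ σ 0
      omega
    · refine ⟨j, by omega, ?_⟩
      simp only [← ptf_zero_succ n σ]
      exact ⟨h2, h3, h4⟩
  · rintro ⟨j, h1, h2, h3, h4⟩
    simp only [← ptf_zero_succ n σ] at h2 h3 h4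
    exact ⟨j + 1, by omega, h2, h3, h4⟩

lemma ptf_succ_le (n : ℕ) (τ : Equiv.Perm (Fin (n+1))) (p : Fin (n+1)) (hp : τ p = Fin.last n)
    (k : ℕ) (hk : k ≠ p) : permToFun (n+1) τ k < permToFun (n+1) τ p := by
  have hv : permToFun (n+1) τ p = n + 1 := by
    simp [permToFun, hp]; omega
  rw [hv]
  unfold permToFun
  split_ifs with h
  · have : τ ⟨k, h⟩ ≠ Fin.last n := by
      intro h'
      rw [← hp] at h'
      exact hk (congrArg Fin.val (τ.injective h'))
    have := Fin.val_lt_last this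
    omega
  · omega

lemma max_pos (n : ℕ) (τ : Equiv.Perm (Fin (n+1))) (h : n + 1 ∉ circularPeakSet (n+1) τ) :
    τ 0 = Fin.last n ∨ τ (Fin.last n) = Fin.last n := by
  obtain ⟨p, hp⟩ := τ.surjective (Fin.last n)
  by_cases h0 : p = 0
  · left; rw [← h0, hp]
  by_cases h1 : p = Fin.last n
  · right; rw [h1] at hp; exact hp
  exfalso
  apply h
  have h0' : (p : ℕ) ≠ 0 := fun h => h0 (Fin.ext h)
  have h1' : (p : ℕ) < n := Fin.val_lt_last h1
  have hv : permToFun (n+1) τ p = n + 1 := by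
    simp [permToFun, hp]; omega
  rw [mem_cps]
  have e : (p : ℕ) - 1 + 1 = p := by omega
  refine ⟨p - 1, by omega, ?_, ?_, ?_⟩
  · rw [e]; exact ptf_succ_le n τ p hp _ (by omega)
  · rw [e]; exact ptf_succ_le n τ p hp _ (by omega)
  · rw [e, hv]

/-- Lemma 2.1(1): for `n ≥ 3` and `S ⊆ [n]` (so that `n+1 ∉ S`),
`cp_{n+1}(S) = 2 · cp_n(S)`. -/
theorem cp_succ_of_subset (n : ℕ) (hn : 3 ≤ n) (S : Finset ℕ)
    (hS : S ⊆ Finset.Icc 1 n) :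
    cp (n + 1) S = 2 * cp n S := by
  have key : CPperms (n+1) S =
      (CPperms n S).image (insMax n 0) ∪ (CPperms n S).image (insMax n (Fin.last n)) := by
    ext τ
    simp only [CPperms, Finset.mem_union, Finset.mem_image, Finset.mem_filter, Finset.mem_univ,
      true_and]
    constructor
    · intro h
      have hnot : n + 1 ∉ circularPeakSet (n+1) τ := by
        rw [h]; intro hm
        have := Finset.mem_Icc.mp (hS hm)
        omega
      rcases max_pos n τ hnot with h0 | h0
      · obtain ⟨σ, rfl⟩ := insMax_surj n _ τ h0
        exact Or.inl ⟨σ, by rw [← cps_zero, h], rfl⟩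
      · obtain ⟨σ, rfl⟩ := insMax_surj n _ τ h0
        exact Or.inr ⟨σ, by rw [← cps_last, h], rfl⟩
    · rintro (⟨σ, h, rfl⟩ | ⟨σ, h, rfl⟩)
      · rw [cps_zero, h]
      · rw [cps_last, h]
  have hd : Disjoint ((CPperms n S).image (insMax n 0))
      ((CPperms n S).image (insMax n (Fin.last n))) := by
    rw [Finset.disjoint_left]
    intro τ h1 h2
    obtain ⟨σ, -, rfl⟩ := Finset.mem_image.mp h1
    obtain ⟨ρ, -, h⟩ := Finset.mem_image.mp h2
    have e1 := insMax_self n 0 σ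
    have e2 := insMax_self n (Fin.last n) ρ
    rw [h] at e2
    have := congrArg Fin.val ((insMax n 0 σ).injective (e2.trans e1.symm))
    rw [Fin.val_last, Fin.val_zero] at this
    omega
  unfold cp
  rw [key, Finset.card_union_of_disjoint hd, Finset.card_image_of_injective _ (insMax_inj n _),
    Finset.card_image_of_injective _ (insMax_inj n _)]
  omega
end

section
/- For every n ≥ 3 and every i with 3 ≤ i ≤ n, the number of permutations of [n] whose circular peak set is the singleton {i} is cp_n({i}) = 2^{n−2}·(2^{i−2} − 1). -/
open Classical in
noncomputable def cpW (S : Finset ℕ) : Finset (List ℕ) := S.toList.permutations.toFinset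

theorem mem_cpW {S : Finset ℕ} {l : List ℕ} : l ∈ cpW S ↔ l.Nodup ∧ ∀ x, x ∈ l ↔ x ∈ S := by
  unfold cpW
  rw [List.mem_toFinset, List.mem_permutations]
  constructor
  · intro h
    exact ⟨h.nodup_iff.2 S.nodup_toList, fun x => by rw [h.mem_iff, Finset.mem_toList]⟩
  · rintro ⟨h1, h2⟩
    rw [List.perm_ext_iff_of_nodup h1 S.nodup_toList]
    intro x; rw [h2, Finset.mem_toList]

def cpK (l : List ℕ) (b : ℕ) : Prop := ∃ a c, [a, b, c] <:+: l ∧ a < b ∧ c < b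

theorem cpK_cons {m : ℕ} {l : List ℕ} (h : ∀ x ∈ l, x < m) (b : ℕ) : cpK (m :: l) b ↔ cpK l b := by
  constructor
  · rintro ⟨a, c, h1, h2, h3⟩
    rw [List.infix_cons_iff] at h1
    rcases h1 with h1 | h1
    · rw [List.cons_prefix_cons] at h1
      have := h b (h1.2.subset (by simp))
      omega
    · exact ⟨a, c, h1, h2, h3⟩
  · rintro ⟨a, c, h1, h2, h3⟩
    exact ⟨a, c, List.infix_cons_iff.2 (Or.inr h1), h2, h3⟩

theorem cpK_reverse {l : List ℕ} (b : ℕ) : cpK l.reverse b ↔ cpK l b := by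
  have key : ∀ l : List ℕ, cpK l b → cpK l.reverse b := by
    rintro l ⟨a, c, h1, h2, h3⟩
    exact ⟨c, a, by simpa using List.reverse_infix.2 h1, h3, h2⟩
  exact ⟨fun h => by simpa using key _ h, key l⟩

theorem cpK_concat {m : ℕ} {l : List ℕ} (h : ∀ x ∈ l, x < m) (b : ℕ) :
    cpK (l ++ [m]) b ↔ cpK l b := by
  rw [← cpK_reverse, List.reverse_append]
  simp only [List.reverse_cons, List.reverse_nil, List.nil_append, List.singleton_append]
  rw [cpK_cons (by simpa using h), cpK_reverse]

theorem cpK_mid {m : ℕ} {u v : List ℕ} (hu : ∀ x ∈ u, x < m) (hv : ∀ x ∈ v, x < m)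
    (hu0 : u ≠ []) (hv0 : v ≠ []) : cpK (u ++ m :: v) m := by
  obtain ⟨u', a, rfl⟩ := List.eq_nil_or_concat u |>.resolve_left hu0
  obtain ⟨c, v', rfl⟩ := List.exists_cons_of_ne_nil hv0
  exact ⟨a, c, ⟨u', v', by simp⟩, hu a (by simp), hv c (by simp)⟩

theorem cpK_append {m b : ℕ} {u v : List ℕ} (hu : ∀ x ∈ u, x < m) (hv : ∀ x ∈ v, x < m)
    (h : cpK (u ++ m :: v) b) : b = m ∨ cpK u b ∨ cpK v b := by
  obtain ⟨a, c, ⟨s, t, h1⟩, h2, h3⟩ := h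
  have hb : b ≤ m := by
    have : b ∈ u ++ m :: v := by rw [← h1]; simp
    simp only [List.mem_append, List.mem_cons] at this
    rcases this with h | h | h
    · exact (hu _ h).le
    · exact h.le
    · exact (hv _ h).le
  by_cases hbm : b = m
  · exact Or.inl hbm
  right
  rw [List.append_assoc, List.append_eq_append_iff] at h1
  rcases h1 with ⟨w, rfl, h1⟩ | ⟨w, rfl, h1⟩
  · left
    rcases w with _ | ⟨x, _ | ⟨y, _ | ⟨z, w⟩⟩⟩ <;> simp at h1
    · omega
    · omega
    · omega
    · obtain ⟨rfl, rfl, rfl, -⟩ := h1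
      exact ⟨a, c, ⟨s, w, by simp⟩, h2, h3⟩
  · rcases w with _ | ⟨x, w⟩
    · simp at h1; omega
    · simp at h1
      right
      exact ⟨a, c, ⟨w, t, by simp [h1.2]⟩, h2, h3⟩

theorem cpK_left {u v : List ℕ} {b : ℕ} (h : cpK u b) : cpK (u ++ v) b := by
  obtain ⟨a, c, h1, h2⟩ := h
  exact ⟨a, c, h1.trans (List.prefix_append _ _).isInfix, h2⟩

theorem cpK_right {u v : List ℕ} {b : ℕ} (h : cpK v b) : cpK (u ++ v) b := by
  obtain ⟨a, c, h1, h2⟩ := h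
  exact ⟨a, c, h1.trans (List.suffix_append _ _).isInfix, h2⟩

theorem cpK_mem {u : List ℕ} {b : ℕ} (h : cpK u b) : b ∈ u := by
  obtain ⟨a, c, h1, h2⟩ := h
  exact h1.subset (by simp)

open Classical in
noncomputable def cpF (S T : Finset ℕ) : Finset (List ℕ) :=
  (cpW S).filter (fun l => ∀ b, cpK l b ↔ b ∈ T)

theorem mem_cpF {S T : Finset ℕ} {l : List ℕ} : l ∈ cpF S T ↔
    (l.Nodup ∧ ∀ x, x ∈ l ↔ x ∈ S) ∧ ∀ b, cpK l b ↔ b ∈ T := by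
  classical
  unfold cpF
  rw [Finset.mem_filter, mem_cpW]

theorem cpF_insert {S T : Finset ℕ} {m : ℕ} (hS : ∀ x ∈ S, x < m) (hT : m ∉ T)
    (hne : S.Nonempty) : (cpF (insert m S) T).card = 2 * (cpF S T).card := by
  classical
  have hmS : m ∉ S := fun h => lt_irrefl _ (hS m h)
  have : cpF (insert m S) T =
      (cpF S T).image (fun l => m :: l) ∪ (cpF S T).image (fun l => l ++ [m]) := by
    ext l
    rw [Finset.mem_union, Finset.mem_image, Finset.mem_image]
    constructor
    · intro h
      rw [mem_cpF] at h
      obtain ⟨⟨hnd, hm⟩, hp⟩ := h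
      have hml : m ∈ l := (hm m).2 (by simp)
      obtain ⟨u, v, rfl⟩ := List.append_of_mem hml
      have hnd' := List.nodup_middle.1 hnd
      rw [List.nodup_cons] at hnd'
      have hm' : ∀ x, x ∈ u ++ v ↔ x ∈ S := by
        intro x
        have h1 := hm x
        by_cases hx : x = m
        · subst hx; tauto
        · simp only [List.mem_append, List.mem_cons, Finset.mem_insert, hx, false_or] at h1 ⊢
          exact h1
      have hlt : ∀ x ∈ u ++ v, x < m := fun x hx => hS x ((hm' x).1 hx)
      by_cases hu : u = []
      · subst hu
        left
        refine ⟨v, mem_cpF.2 ⟨⟨hnd'.2, hm'⟩, fun b => ?_⟩, rfl⟩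
        rw [← hp]; exact (cpK_cons hlt b).symm
      by_cases hv : v = []
      · subst hv
        right
        rw [List.append_nil] at hnd' hm' hlt
        refine ⟨u, mem_cpF.2 ⟨⟨hnd'.2, hm'⟩, fun b => ?_⟩, rfl⟩
        rw [← hp]; exact (cpK_concat hlt b).symm
      exact absurd ((hp m).1 (cpK_mid (fun x hx => hlt x (by simp [hx]))
        (fun x hx => hlt x (by simp [hx])) hu hv)) hT
    · rintro (⟨l, h, rfl⟩ | ⟨l, h, rfl⟩) <;> rw [mem_cpF] at h ⊢ <;>
        obtain ⟨⟨hnd, hm⟩, hp⟩ := h <;>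
        have hlt : ∀ x ∈ l, x < m := fun x hx => hS x ((hm x).1 hx)
      · refine ⟨⟨List.nodup_cons.2 ⟨by rwa [hm], hnd⟩, by simp [hm]⟩, fun b => ?_⟩
        rw [cpK_cons hlt, hp]
      · refine ⟨⟨?_, by simp [hm, or_comm]⟩, fun b => ?_⟩
        · rw [List.nodup_middle]; simp [hnd, hm, hmS]
        rw [cpK_concat hlt, hp]
  rw [this, Finset.card_union_of_disjoint, Finset.card_image_of_injective,
    Finset.card_image_of_injective, two_mul]
  · intro a b h; simpa using h
  · intro a b h; simpa using h
  · rw [Finset.disjoint_left]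
    intro l h1 h2
    rw [Finset.mem_image] at h1 h2
    obtain ⟨u, hu, rfl⟩ := h1
    obtain ⟨v, hv, h⟩ := h2
    rw [mem_cpF] at hv hu
    rcases v with _ | ⟨x, v⟩
    · obtain ⟨y, hy⟩ := hne
      exact absurd ((hv.1.2 y).2 hy) (by simp)
    · simp at h
      exact hmS ((hv.1.2 m).1 (by simp [h.1]))

theorem cpF_empty (S : Finset ℕ) : S.Nonempty → 2 * (cpF S ∅).card = 2 ^ S.card := by
  induction S using Finset.induction_on_max with
  | empty => simp
  | insert m S hS ih =>
    intro _
    have hmS : m ∉ S := fun h => lt_irrefl _ (hS m h)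
    rcases S.eq_empty_or_nonempty with rfl | hne
    · have : cpF (insert m ∅) ∅ = {[m]} := by
        ext l
        rw [mem_cpF, Finset.mem_singleton]
        constructor
        · rintro ⟨⟨h1, h2⟩, -⟩
          have : l.Perm [m] := (List.perm_ext_iff_of_nodup h1 (by simp)).2 (by simpa using h2)
          exact List.perm_singleton.1 this
        · rintro rfl
          refine ⟨by simp, fun b => ?_⟩
          simp only [Finset.notMem_empty, iff_false]
          rintro ⟨a, c, h, -⟩
          have := h.length_le
          simp at this
      rw [this]; simp
    · rw [cpF_insert hS (by simp) hne, ih hne, Finset.card_insert_of_notMem hmS, pow_succ]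
      ring

theorem cp_split_inj {m : ℕ} {u v u' v' : List ℕ} (hu : m ∉ u) (hu' : m ∉ u')
    (h : u ++ m :: v = u' ++ m :: v') : u = u' ∧ v = v' := by
  rw [List.append_eq_append_iff] at h
  rcases h with ⟨w, rfl, h⟩ | ⟨w, rfl, h⟩ <;> rcases w with _ | ⟨x, w⟩ <;> simp_all

theorem cpF_top {S : Finset ℕ} {m : ℕ} (hS : ∀ x ∈ S, x < m) :
    (cpF (insert m S) {m}).card =
      ∑ A ∈ (S.powerset.erase ∅).erase S, (cpF A ∅).card * (cpF (S \ A) ∅).card := by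
  have hmS : m ∉ S := fun h => lt_irrefl _ (hS m h)
  simp_rw [← Finset.card_product]
  rw [← Finset.card_sigma]
  symm
  refine Finset.card_bij (fun p _ => p.2.1 ++ m :: p.2.2) ?_ ?_ ?_
  · rintro ⟨A, u, v⟩ h
    simp only [Finset.mem_sigma, Finset.mem_erase, Finset.mem_powerset, Finset.mem_product,
      mem_cpF, Finset.mem_sdiff] at h ⊢
    obtain ⟨⟨hAS, hA0, hA⟩, ⟨⟨hu, hu1⟩, hu2⟩, ⟨hv, hv1⟩, hv2⟩ := h
    have hlu : ∀ x ∈ u, x < m := fun x hx => hS x (hA ((hu1 x).1 hx))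
    have hlv : ∀ x ∈ v, x < m := fun x hx => hS x ((hv1 x).1 hx).1
    have hu0 : u ≠ [] := by
      rintro rfl
      exact hA0 (Finset.eq_empty_of_forall_notMem fun x hx => by simpa using (hu1 x).2 hx)
    have hv0 : v ≠ [] := by
      rintro rfl
      refine hAS (Finset.Subset.antisymm hA fun x hx => ?_)
      by_contra hxA
      simpa using (hv1 x).2 ⟨hx, hxA⟩
    refine ⟨⟨?_, ?_⟩, ?_⟩
    · rw [List.nodup_middle, List.nodup_cons, List.nodup_append]
      refine ⟨?_, hu, hv, ?_⟩
      · rw [List.mem_append]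
        rintro (h | h)
        · exact lt_irrefl _ (hlu _ h)
        · exact lt_irrefl _ (hlv _ h)
      · rintro a ha b hb rfl
        exact ((hv1 a).1 hb).2 ((hu1 a).1 ha)
    · intro x
      simp only [List.mem_append, List.mem_cons, Finset.mem_insert, hu1, hv1]
      have := @hA x
      tauto
    · intro b
      rw [Finset.mem_singleton]
      constructor
      · intro h
        rcases cpK_append hlu hlv h with h | h | h
        · exact h
        · simpa using (hu2 b).1 h
        · simpa using (hv2 b).1 h
      · rintro rfl
        exact cpK_mid hlu hlv hu0 hv0
  · rintro ⟨A, u, v⟩ h ⟨A', u', v'⟩ h' heq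
    simp only [Finset.mem_sigma, Finset.mem_erase, Finset.mem_powerset, Finset.mem_product,
      mem_cpF] at h h' heq
    obtain ⟨⟨-, -, hA⟩, ⟨⟨-, hu⟩, -⟩, -⟩ := h
    obtain ⟨⟨-, -, hA'⟩, ⟨⟨-, hu'⟩, -⟩, -⟩ := h'
    obtain ⟨rfl, rfl⟩ := cp_split_inj (fun h => hmS (hA ((hu m).1 h)))
      (fun h => hmS (hA' ((hu' m).1 h))) heq
    have : A = A' := by ext x; rw [← hu, hu']
    subst this; rfl
  · intro l h
    rw [mem_cpF] at h
    obtain ⟨⟨hnd, hm⟩, hp⟩ := h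
    obtain ⟨u, v, rfl⟩ := List.append_of_mem ((hm m).2 (by simp))
    have hnd' := List.nodup_middle.1 hnd
    rw [List.nodup_cons] at hnd'
    have hm' : ∀ x, x ∈ u ++ v ↔ x ∈ S := by
      intro x
      have h1 := hm x
      by_cases hx : x = m
      · subst hx; tauto
      · simp only [List.mem_append, List.mem_cons, Finset.mem_insert, hx, false_or] at h1 ⊢
        exact h1
    have hlt : ∀ x ∈ u ++ v, x < m := fun x hx => hS x ((hm' x).1 hx)
    have hpm := (hp m).2 (by simp)
    have hu0 : u ≠ [] := by
      rintro rfl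
      exact hnd'.1 (cpK_mem ((cpK_cons hlt m).1 hpm))
    have hv0 : v ≠ [] := by
      rintro rfl
      rw [List.append_nil] at hlt hnd'
      exact hnd'.1 (cpK_mem ((cpK_concat hlt m).1 hpm))
    have hnu := List.nodup_append.1 hnd'.2
    have hvS : ∀ x, x ∈ v ↔ x ∈ S ∧ x ∉ u := by
      intro x
      rw [← hm', List.mem_append]
      have := hnu.2.2 x
      constructor
      · intro h; exact ⟨Or.inr h, fun h' => this h' x h rfl⟩
      · tauto
    refine ⟨⟨u.toFinset, u, v⟩, ?_, rfl⟩
    simp only [Finset.mem_sigma, Finset.mem_erase, Finset.mem_powerset, Finset.mem_product,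
      mem_cpF, Finset.mem_sdiff, List.mem_toFinset]
    refine ⟨⟨?_, ?_, ?_⟩, ⟨⟨hnu.1, by simp⟩, ?_⟩, ⟨hnu.2.1, hvS⟩, ?_⟩
    · intro h
      obtain ⟨x, v', rfl⟩ := List.exists_cons_of_ne_nil hv0
      have := (hvS x).1 (by simp)
      rw [← h, List.mem_toFinset] at this
      exact this.2 this.1
    · simpa using hu0
    · intro x hx
      exact (hm' x).1 (by simp [List.mem_toFinset.1 hx])
    · intro b
      simp only [Finset.notMem_empty, iff_false]
      intro h
      have : b = m := by simpa using (hp b).1 (cpK_left h)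
      exact hnd'.1 (by rw [← this]; simp [cpK_mem h])
    · intro b
      simp only [Finset.notMem_empty, iff_false]
      intro h
      have : b = m := by
        have := (hp b).1 (by
          have := cpK_right (u := u ++ [m]) h
          simpa using this)
        simpa using this
      exact hnd'.1 (by rw [← this]; simp [cpK_mem h])

theorem cpF_top_card {S : Finset ℕ} {m : ℕ} (hS : ∀ x ∈ S, x < m) (hc : 2 ≤ S.card) :
    (cpF (insert m S) {m}).card = 2 ^ (S.card - 1) * (2 ^ (S.card - 1) - 1) := by
  have h4 : 4 * (cpF (insert m S) {m}).card = (2 ^ S.card - 2) * 2 ^ S.card := by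
    rw [cpF_top hS, Finset.mul_sum]
    have hne : S ≠ ∅ := by rintro rfl; simp at hc
    rw [Finset.sum_congr rfl (g := fun _ => 2 ^ S.card), Finset.sum_const,
      Finset.card_erase_of_mem (by simp [hne]), Finset.card_erase_of_mem (by simp),
      Finset.card_powerset, smul_eq_mul, Nat.sub_sub]
    intro A hA
    simp only [Finset.mem_erase, Finset.mem_powerset] at hA
    have h1 := cpF_empty A (Finset.nonempty_iff_ne_empty.2 hA.2.1)
    have h2 := cpF_empty (S \ A) (Finset.sdiff_nonempty.2
      (fun h => hA.1 (Finset.Subset.antisymm hA.2.2 h)))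
    have h3 := Finset.card_sdiff_add_card_eq_card hA.2.2
    rw [← h3, pow_add, ← h1, ← h2]
    ring
  obtain ⟨k, hk⟩ : ∃ k, S.card = k + 1 := ⟨S.card - 1, by omega⟩
  rw [hk] at h4 ⊢
  simp only [Nat.add_sub_cancel]
  have : 2 ^ (k + 1) - 2 = 2 * (2 ^ k - 1) := by rw [pow_succ]; omega
  rw [this, pow_succ] at h4
  nlinarith

theorem cpF_card (i : ℕ) (hi : 3 ≤ i) (n : ℕ) (hin : i ≤ n) :
    (cpF (Finset.Icc 1 n) {i}).card = 2 ^ (n - 2) * (2 ^ (i - 2) - 1) := by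
  induction n, hin using Nat.le_induction with
  | base =>
    have : Finset.Icc 1 i = insert i (Finset.Icc 1 (i - 1)) := by
      ext x; simp only [Finset.mem_insert, Finset.mem_Icc]; omega
    rw [this, cpF_top_card]
    · simp only [Nat.card_Icc]
      congr 2
    · intro x; rw [Finset.mem_Icc]; omega
    · simp; omega
  | succ n hn ih =>
    have : Finset.Icc 1 (n + 1) = insert (n + 1) (Finset.Icc 1 n) := by
      ext x; simp only [Finset.mem_insert, Finset.mem_Icc]; omega
    rw [this, cpF_insert, ih, show n + 1 - 2 = (n - 2) + 1 by omega, pow_succ]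
    · ring
    · intro x; rw [Finset.mem_Icc]; omega
    · rw [Finset.mem_singleton]; omega
    · exact ⟨1, by simp; omega⟩

def cpL (n : ℕ) (σ : Equiv.Perm (Fin n)) : List ℕ := List.ofFn (fun j => (σ j : ℕ) + 1)

theorem cpL_get (n : ℕ) (σ : Equiv.Perm (Fin n)) (j : ℕ) (hj : j < n) :
    (cpL n σ)[j]? = some (permToFun n σ j) := by
  simp [cpL, permToFun, hj]

theorem cpL_len (n : ℕ) (σ : Equiv.Perm (Fin n)) : (cpL n σ).length = n := by
  simp [cpL]

theorem cpL_peak (n : ℕ) (σ : Equiv.Perm (Fin n)) (b : ℕ) :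
    cpK (cpL n σ) b ↔ b ∈ circularPeakSet n σ := by
  simp only [circularPeakSet, Finset.mem_image, Finset.mem_filter, Finset.mem_Ioo]
  constructor
  · rintro ⟨a, c, ⟨s, t, h⟩, h1, h2⟩
    have hlen := congrArg List.length h
    rw [cpL_len] at hlen
    simp at hlen
    have e0 := cpL_get n σ s.length (by omega)
    have e1 := cpL_get n σ (s.length + 1) (by omega)
    have e2 := cpL_get n σ (s.length + 2) (by omega)
    rw [← h] at e0 e1 e2
    simp at e0 e1 e2
    refine ⟨s.length + 1, ⟨by omega, ?_, ?_⟩, e1.symm⟩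
    · rw [Nat.add_sub_cancel]; omega
    · rw [show s.length + 1 + 1 = s.length + 2 by rfl]; omega
  · rintro ⟨j, ⟨⟨h0, hj⟩, h1, h2⟩, rfl⟩
    refine ⟨_, _, ?_, h1, h2⟩
    rw [List.infix_iff_getElem?]
    refine ⟨j - 1, ?_, ?_⟩
    · rw [cpL_len]; simp; omega
    · intro k hk
      simp at hk
      interval_cases k
      · simpa using cpL_get n σ (j - 1) (by omega)
      · rw [show 1 + (j - 1) = j by omega]
        simpa using cpL_get n σ j (by omega)
      · rw [show 2 + (j - 1) = j + 1 by omega]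
        simpa using cpL_get n σ (j + 1) (by omega)

theorem cp_eq_cpF (n : ℕ) (T : Finset ℕ) : cp n T = (cpF (Finset.Icc 1 n) T).card := by
  unfold cp
  refine Finset.card_bij (fun σ _ => cpL n σ) ?_ ?_ ?_
  · intro σ h
    simp only [CPperms, Finset.mem_filter, Finset.mem_univ, true_and] at h
    rw [mem_cpF]
    refine ⟨⟨?_, ?_⟩, fun b => by rw [cpL_peak, h]⟩
    · unfold cpL
      rw [List.nodup_ofFn]
      intro a b h
      exact σ.injective (Fin.ext (by simpa using h))
    · intro x
      simp only [cpL, List.mem_ofFn, Finset.mem_Icc]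
      constructor
      · rintro ⟨j, rfl⟩
        have := (σ j).2
        omega
      · intro hx
        refine ⟨σ.symm ⟨x - 1, by omega⟩, ?_⟩
        simp; omega
  · intro σ _ τ _ h
    have := List.ofFn_injective h
    ext j
    simpa using congrFun this j
  · intro l h
    rw [mem_cpF] at h
    obtain ⟨⟨hnd, hm⟩, hp⟩ := h
    have hlen : l.length = n := by
      rw [← List.toFinset_card_of_nodup hnd,
        show l.toFinset = Finset.Icc 1 n by ext x; rw [List.mem_toFinset, hm]]
      simp
    have hr : ∀ j : Fin n, 1 ≤ l[j] ∧ l[j] ≤ n := fun j => by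
      have := (hm (l[j])).1 (List.getElem_mem _)
      simpa using this
    let f : Fin n → Fin n := fun j => ⟨l[j] - 1, by have := hr j; omega⟩
    have hf : Function.Injective f := by
      intro a b hab
      have h1 := hr a
      have h2 := hr b
      have h3 : l[a] - 1 = l[b] - 1 := congrArg Fin.val hab
      have h4 : l[a] = l[b] := by omega
      exact Fin.ext ((hnd.getElem_inj_iff).1 h4)
    let σ : Equiv.Perm (Fin n) := Equiv.ofBijective f (Finite.injective_iff_bijective.1 hf)
    have hσ : cpL n σ = l := by
      apply List.ext_getElem
      · rw [cpL_len, hlen]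
      · intro j h1 h2
        have := hr ⟨j, by omega⟩
        simp only [Fin.getElem_fin] at this
        simp [cpL, σ, f]
        omega
    refine ⟨σ, ?_, hσ⟩
    simp only [CPperms, Finset.mem_filter, Finset.mem_univ, true_and]
    ext b
    rw [← cpL_peak, hσ, hp]

/-- Theorem 2.1(2): for `n ≥ 3` and `3 ≤ i ≤ n`, `cp_n({i}) = 2^{n-2}(2^{i-2} - 1)`. -/
theorem cp_singleton (n i : ℕ) (hn : 3 ≤ n) (hi : 3 ≤ i) (hin : i ≤ n) :
    cp n ({i} : Finset ℕ) = 2 ^ (n - 2) * (2 ^ (i - 2) - 1) := by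
  rw [cp_eq_cpF, cpF_card i hi n hin]
end

section
/- Let n ≥ 3 and S ⊆ [n−1]. Then, as an identity of integers, cp_n(S ∪ {n}) = (n − 2 − 2|S|)·cp_{n−1}(S) + Σ_{j ∈ [n−1] \ S} 2·cp_{n−1}(S ∪ {j}). -/
/-- Insert the largest letter at position `p`. -/
def insTop (m : ℕ) (p : Fin (m + 1)) (τ : Equiv.Perm (Fin m)) : Equiv.Perm (Fin (m + 1)) :=
  ((finSuccEquiv' p).trans (Equiv.optionCongr τ)).trans (finSuccEquiv' (Fin.last m)).symm

theorem insTop_self (m : ℕ) (p : Fin (m + 1)) (τ : Equiv.Perm (Fin m)) :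
    insTop m p τ p = Fin.last m := by
  simp [insTop]

theorem insTop_succAbove (m : ℕ) (p : Fin (m + 1)) (τ : Equiv.Perm (Fin m)) (i : Fin m) :
    insTop m p τ (p.succAbove i) = (τ i).castSucc := by
  simp [insTop]

theorem insTop_bij (m : ℕ) :
    Function.Bijective (fun x : Fin (m + 1) × Equiv.Perm (Fin m) => insTop m x.1 x.2) := by
  rw [Fintype.bijective_iff_injective_and_card]
  constructor
  · rintro ⟨p, τ⟩ ⟨q, ρ⟩ h
    have h' : insTop m p τ = insTop m q ρ := h
    have hpq : p = q := by
      apply (insTop m q ρ).injective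
      rw [insTop_self, ← h', insTop_self]
    subst hpq
    have : τ = ρ := by
      ext i
      have h1 := insTop_succAbove m p τ i
      rw [h', insTop_succAbove] at h1
      have := congrArg Fin.val h1
      simpa using this.symm
    rw [this]
  · simp [Fintype.card_perm, Nat.factorial_succ]

theorem permToFun_ins (m : ℕ) (p : Fin (m + 1)) (τ : Equiv.Perm (Fin m)) (j : ℕ) :
    permToFun (m + 1) (insTop m p τ) j =
      if j < (p : ℕ) then permToFun m τ j else if j = (p : ℕ) then m + 1
        else permToFun m τ (j - 1) := by
  have hp := p.2
  split_ifs with h1 h2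
  · have hj : j < m := by omega
    have h3 : (⟨j, by omega⟩ : Fin (m + 1)) = p.succAbove ⟨j, hj⟩ := by
      rw [Fin.succAbove_of_castSucc_lt _ _ (by simpa [Fin.lt_def] using h1)]; rfl
    have h4 : j < m + 1 := by omega
    simp only [permToFun, hj, h4, dif_pos, h3, insTop_succAbove, Fin.val_castSucc]
  · have h3 : (⟨j, by omega⟩ : Fin (m + 1)) = p := Fin.ext h2
    have h4 : j < m + 1 := by omega
    simp only [permToFun, h4, dif_pos, h3, insTop_self, Fin.val_last]
  · by_cases hj : j < m + 1
    · have hj' : j - 1 < m := by omega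
      have h3 : (⟨j, by omega⟩ : Fin (m + 1)) = p.succAbove ⟨j - 1, hj'⟩ := by
        rw [Fin.succAbove_of_le_castSucc _ _ (by simp [Fin.le_def]; omega)]
        apply Fin.ext; simp; omega
      simp only [permToFun, hj, hj', dif_pos, h3, insTop_succAbove, Fin.val_castSucc]
    · have hj' : ¬ j - 1 < m := by omega
      simp only [permToFun, hj, hj', dif_neg, not_false_eq_true]

theorem permToFun_le (m : ℕ) (τ : Equiv.Perm (Fin m)) (j : ℕ) : permToFun m τ j ≤ m := by
  unfold permToFun
  split_ifs with h
  · exact (τ ⟨j, h⟩).2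
  · omega

theorem permToFun_pos (m : ℕ) (τ : Equiv.Perm (Fin m)) (j : ℕ) (h : j < m) :
    1 ≤ permToFun m τ j := by
  simp [permToFun, h]

theorem permToFun_inj (m : ℕ) (τ : Equiv.Perm (Fin m)) (i j : ℕ) (hi : i < m) (hj : j < m)
    (h : permToFun m τ i = permToFun m τ j) : i = j := by
  simp only [permToFun, hi, hj, dif_pos] at h
  have := τ.injective (Fin.ext (by omega : (τ ⟨i, hi⟩ : ℕ) = τ ⟨j, hj⟩))
  simpa using this

/-- Peak positions. -/
def pkPos (m : ℕ) (τ : Equiv.Perm (Fin m)) : Finset ℕ :=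
  (Finset.Ioo 0 (m - 1)).filter (fun j =>
    permToFun m τ (j - 1) < permToFun m τ j ∧ permToFun m τ (j + 1) < permToFun m τ j)

theorem mem_pkPos (m : ℕ) (τ : Equiv.Perm (Fin m)) (j : ℕ) :
    j ∈ pkPos m τ ↔ (0 < j ∧ j + 1 < m) ∧
      permToFun m τ (j - 1) < permToFun m τ j ∧ permToFun m τ (j + 1) < permToFun m τ j := by
  simp only [pkPos, Finset.mem_filter, Finset.mem_Ioo]
  constructor <;> rintro ⟨h1, h2⟩ <;> exact ⟨by omega, h2⟩

theorem cps_eq (m : ℕ) (τ : Equiv.Perm (Fin m)) :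
    circularPeakSet m τ = (pkPos m τ).image (permToFun m τ) := rfl

theorem mem_cps_s5 (m : ℕ) (τ : Equiv.Perm (Fin m)) (i : ℕ) (hi : i < m) :
    permToFun m τ i ∈ circularPeakSet m τ ↔ i ∈ pkPos m τ := by
  rw [cps_eq, Finset.mem_image]
  constructor
  · rintro ⟨j, hj, h⟩
    have h2 := (mem_pkPos m τ j).1 hj
    rwa [← permToFun_inj m τ j i (by omega) hi h]
  · exact fun h => ⟨i, h, rfl⟩

theorem card_cps (m : ℕ) (τ : Equiv.Perm (Fin m)) :
    (circularPeakSet m τ).card = (pkPos m τ).card := by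
  rw [cps_eq]
  apply Finset.card_image_of_injOn
  intro i hi j hj h
  have h1 := (mem_pkPos m τ i).1 hi
  have h2 := (mem_pkPos m τ j).1 hj
  exact permToFun_inj m τ i j (by omega) (by omega) h

theorem cps_sub (m : ℕ) (τ : Equiv.Perm (Fin m)) :
    circularPeakSet m τ ⊆ Finset.Icc 1 m := by
  intro x hx
  rw [cps_eq, Finset.mem_image] at hx
  obtain ⟨j, hj, rfl⟩ := hx
  have h2 := (mem_pkPos m τ j).1 hj
  exact Finset.mem_Icc.2 ⟨permToFun_pos m τ j (by omega), permToFun_le m τ j⟩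

theorem pk_ins (m : ℕ) (p : Fin (m + 1)) (τ : Equiv.Perm (Fin m)) (j : ℕ) :
    j ∈ pkPos (m + 1) (insTop m p τ) ↔
      (j = (p : ℕ) ∧ 0 < j ∧ j < m) ∨ (j + 1 < (p : ℕ) ∧ j ∈ pkPos m τ) ∨
      ((p : ℕ) + 1 < j ∧ j - 1 ∈ pkPos m τ) := by
  have hp := p.2
  rw [mem_pkPos, mem_pkPos, mem_pkPos]
  simp only [permToFun_ins]
  have l := permToFun_le m τ
  rcases lt_trichotomy (j + 1) (p : ℕ) with h | h | h
  · rw [if_pos (by omega), if_pos (by omega), if_pos h]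
    constructor
    · rintro ⟨h1, h2⟩; exact Or.inr (Or.inl ⟨h, by omega, h2⟩)
    · rintro (h1 | ⟨_, h1, h2⟩ | h1)
      · omega
      · exact ⟨by omega, h2⟩
      · omega
  · rw [if_pos (by omega), if_pos (by omega), if_neg (by omega), if_pos h]
    have := l j
    constructor <;> intro <;> omega
  · rcases lt_trichotomy j ((p : ℕ) + 1) with h' | h' | h'
    · have hj : j = (p : ℕ) := by omega
      rw [if_neg (by omega : ¬ j < (p : ℕ)), if_pos hj]
      rw [if_neg (by omega : ¬ j + 1 < (p : ℕ)), if_neg (by omega : ¬ j + 1 = (p : ℕ))]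
      constructor
      · rintro ⟨h1, h2⟩; exact Or.inl (by omega)
      · rintro (h1 | h1 | h1)
        · refine ⟨by omega, ?_, ?_⟩
          · rw [if_pos (by omega)]; have := l (j - 1); omega
          · have := l (j + 1 - 1); omega
        · omega
        · omega
    · rw [if_neg (by omega), if_pos (by omega : j - 1 = (p : ℕ)), if_neg (by omega : ¬ j < (p : ℕ)),
        if_neg (by omega : ¬ j = (p : ℕ))]
      have := l (j - 1)
      constructor <;> intro <;> omega
    · rw [if_neg (by omega : ¬ j - 1 < (p : ℕ)), if_neg (by omega : ¬ j - 1 = (p : ℕ)),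
        if_neg (by omega : ¬ j < (p : ℕ)), if_neg (by omega : ¬ j = (p : ℕ)),
        if_neg (by omega : ¬ j + 1 < (p : ℕ)), if_neg (by omega : ¬ j + 1 = (p : ℕ))]
      have e : j + 1 - 1 = j - 1 + 1 := by omega
      rw [e]
      constructor
      · rintro ⟨h1, h2⟩; exact Or.inr (Or.inr ⟨h', by omega, h2⟩)
      · rintro (h1 | h1 | ⟨_, h1, h2⟩)
        · omega
        · omega
        · exact ⟨by omega, h2⟩

theorem cps_ins (m : ℕ) (p : Fin (m + 1)) (τ : Equiv.Perm (Fin m)) (h0 : 0 < (p : ℕ))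
    (hm : (p : ℕ) < m) :
    circularPeakSet (m + 1) (insTop m p τ) =
      insert (m + 1) (circularPeakSet m τ \ {permToFun m τ (p - 1), permToFun m τ p}) := by
  ext x
  rw [cps_eq]
  simp only [Finset.mem_image, pk_ins, Finset.mem_insert, Finset.mem_sdiff, Finset.mem_singleton,
    permToFun_ins]
  constructor
  · rintro ⟨j, (⟨h1, h2⟩ | ⟨h1, h2⟩ | ⟨h1, h2⟩), rfl⟩
    · left; rw [if_neg (by omega), if_pos h1]
    · right
      have h3 := (mem_pkPos m τ j).1 h2
      rw [if_pos (by omega), mem_cps_s5 m τ j (by omega)]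
      refine ⟨h2, ?_⟩
      rintro (h | h)
      · have := permToFun_inj m τ _ _ (by omega) (by omega) h; omega
      · have := permToFun_inj m τ _ _ (by omega) (by omega) h; omega
    · right
      have h3 := (mem_pkPos m τ (j - 1)).1 h2
      rw [if_neg (by omega), if_neg (by omega), mem_cps_s5 m τ (j - 1) (by omega)]
      refine ⟨h2, ?_⟩
      rintro (h | h)
      · have := permToFun_inj m τ _ _ (by omega) (by omega) h; omega
      · have := permToFun_inj m τ _ _ (by omega) (by omega) h; omega
  · rintro (rfl | ⟨hx, hn⟩)
    · exact ⟨p, Or.inl ⟨rfl, h0, hm⟩, by simp⟩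
    · rw [cps_eq, Finset.mem_image] at hx
      obtain ⟨i, hi, rfl⟩ := hx
      have h1 : i ≠ (p : ℕ) - 1 := fun h => hn (Or.inl (by rw [h]))
      have h2 : i ≠ (p : ℕ) := fun h => hn (Or.inr (by rw [h]))
      by_cases h : i < (p : ℕ)
      · exact ⟨i, Or.inr (Or.inl ⟨by omega, hi⟩), by rw [if_pos h]⟩
      · refine ⟨i + 1, Or.inr (Or.inr ⟨by omega, by simpa using hi⟩), ?_⟩
        rw [if_neg (by omega), if_neg (by omega)]; rfl

theorem cps_ins_iff (m : ℕ) (p : Fin (m + 1)) (τ : Equiv.Perm (Fin m)) (S : Finset ℕ)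
    (hS : S ⊆ Finset.Icc 1 m) :
    circularPeakSet (m + 1) (insTop m p τ) = S ∪ {m + 1} ↔
      (0 < (p : ℕ) ∧ (p : ℕ) < m) ∧
        circularPeakSet m τ \ {permToFun m τ (p - 1), permToFun m τ p} = S := by
  have hp := p.2
  have hS' : m + 1 ∉ S := fun h => by have := Finset.mem_Icc.1 (hS h); omega
  by_cases h : 0 < (p : ℕ) ∧ (p : ℕ) < m
  · rw [cps_ins m p τ h.1 h.2]
    have hC : m + 1 ∉ circularPeakSet m τ \ {permToFun m τ (p - 1), permToFun m τ p} := by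
      intro h
      have := Finset.mem_Icc.1 (cps_sub m τ (Finset.mem_sdiff.1 h).1); omega
    rw [Finset.union_comm, ← Finset.insert_eq]
    constructor
    · intro e
      refine ⟨h, ?_⟩
      rw [← Finset.erase_insert hC, e, Finset.erase_insert hS']
    · rintro ⟨_, e⟩; rw [e]
  · constructor
    · intro e
      exfalso
      have h2 := permToFun_ins m p τ p
      rw [if_neg (by omega), if_pos rfl] at h2
      have h1 : permToFun (m + 1) (insTop m p τ) p ∈
          circularPeakSet (m + 1) (insTop m p τ) := by rw [e, h2]; simp
      rw [mem_cps_s5 _ _ _ hp, pk_ins] at h1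
      omega
    · exact fun e => absurd e.1 h

/-- Good insertion places. -/
def goodPos (m : ℕ) (τ : Equiv.Perm (Fin m)) (S : Finset ℕ) : Finset ℕ :=
  (Finset.Ioo 0 m).filter (fun p =>
    circularPeakSet m τ \ {permToFun m τ (p - 1), permToFun m τ p} = S)

theorem mem_goodPos (m : ℕ) (τ : Equiv.Perm (Fin m)) (S : Finset ℕ) (p : ℕ) :
    p ∈ goodPos m τ S ↔ (0 < p ∧ p < m) ∧
      circularPeakSet m τ \ {permToFun m τ (p - 1), permToFun m τ p} = S := by
  simp [goodPos]

theorem cp_eq_sum (m : ℕ) (S : Finset ℕ) (hS : S ⊆ Finset.Icc 1 m) :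
    cp (m + 1) (S ∪ {m + 1}) = ∑ τ : Equiv.Perm (Fin m), (goodPos m τ S).card := by
  unfold cp CPperms
  rw [← Finset.card_sigma]
  symm
  refine Finset.card_bij (fun x _ => insTop m (Fin.ofNat (m + 1) x.2) x.1) ?_ ?_ ?_
  · rintro ⟨τ, p⟩ h
    simp only [Finset.mem_sigma, Finset.mem_univ, true_and, mem_goodPos] at h
    have e : ((Fin.ofNat (m + 1) p : Fin (m + 1)) : ℕ) = p := by
      simp [Fin.ofNat]; omega
    simp only [Finset.mem_filter, Finset.mem_univ, true_and, cps_ins_iff m _ _ S hS, e]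
    exact h
  · rintro ⟨τ, p⟩ h ⟨ρ, q⟩ h' hh
    simp only [Finset.mem_sigma, Finset.mem_univ, true_and, mem_goodPos] at h h'
    have := (insTop_bij m).1 (a₁ := (Fin.ofNat (m + 1) p, τ)) (a₂ := (Fin.ofNat (m + 1) q, ρ)) hh
    rw [Prod.mk.injEq] at this
    obtain ⟨h1, rfl⟩ := this
    have h2 := congrArg Fin.val h1
    simp only [Fin.ofNat] at h2
    rw [Nat.mod_eq_of_lt (by omega), Nat.mod_eq_of_lt (by omega)] at h2
    rw [h2]
  · intro σ hσ
    obtain ⟨⟨p, τ⟩, rfl⟩ := (insTop_bij m).2 σ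
    simp only [Finset.mem_filter, Finset.mem_univ, true_and, cps_ins_iff m _ _ S hS] at hσ
    have e : Fin.ofNat (m + 1) (p : ℕ) = p := by
      apply Fin.ext; simp [Fin.ofNat]; omega
    refine ⟨⟨τ, p⟩, ?_, ?_⟩
    · simp only [Finset.mem_sigma, Finset.mem_univ, true_and, mem_goodPos]; exact hσ
    · simp only [e]

theorem good_eq (m : ℕ) (hm : 2 ≤ m) (τ : Equiv.Perm (Fin m)) (S : Finset ℕ)
    (h : circularPeakSet m τ = S) :
    (goodPos m τ S).card + 2 * S.card + 1 = m := by
  have hc : S.card = (pkPos m τ).card := by rw [← h, card_cps]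
  have e : goodPos m τ S = Finset.Ioo 0 m \ (pkPos m τ ∪ (pkPos m τ).image (· + 1)) := by
    ext p
    rw [mem_goodPos, ← h, sdiff_eq_left, Finset.mem_sdiff, Finset.mem_Ioo]
    apply and_congr_right
    intro hp
    simp only [Finset.disjoint_insert_right, Finset.disjoint_singleton_right,
      mem_cps_s5 m τ p hp.2, mem_cps_s5 m τ (p - 1) (by omega : p - 1 < m), Finset.mem_union,
      Finset.mem_image]
    have : (∃ a ∈ pkPos m τ, a + 1 = p) ↔ p - 1 ∈ pkPos m τ := by
      constructor
      · rintro ⟨a, ha, rfl⟩; simpa using ha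
      · intro h; exact ⟨_, h, by omega⟩
    rw [this]; tauto
  have hd : Disjoint (pkPos m τ) ((pkPos m τ).image (· + 1)) := by
    rw [Finset.disjoint_left]
    intro a ha hb
    obtain ⟨b, hb', rfl⟩ := Finset.mem_image.1 hb
    have h1 := (mem_pkPos m τ _).1 ha
    have h2 := (mem_pkPos m τ _).1 hb'
    simp only [Nat.add_sub_cancel] at h1
    omega
  have hsub : pkPos m τ ∪ (pkPos m τ).image (· + 1) ⊆ Finset.Ioo 0 m := by
    intro a ha
    rw [Finset.mem_Ioo]
    rcases Finset.mem_union.1 ha with ha | ha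
    · have h1 := (mem_pkPos m τ _).1 ha; omega
    · obtain ⟨b, hb, rfl⟩ := Finset.mem_image.1 ha
      have h2 := (mem_pkPos m τ _).1 hb
      omega
  have h1 := Finset.card_sdiff_add_card_eq_card hsub
  rw [← e, Finset.card_union_of_disjoint hd,
    Finset.card_image_of_injective _ (add_left_injective 1), Nat.card_Ioo] at h1
  omega

theorem good_insert (m : ℕ) (τ : Equiv.Perm (Fin m)) (S : Finset ℕ) (j : ℕ) (hj : j ∉ S)
    (h : circularPeakSet m τ = S ∪ {j}) :
    (goodPos m τ S).card = 2 := by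
  have hjC : j ∈ circularPeakSet m τ := by rw [h]; simp
  have hjC' := hjC
  rw [cps_eq, Finset.mem_image] at hjC'
  obtain ⟨i, hi, rfl⟩ := hjC'
  have hi' := (mem_pkPos m τ _).1 hi
  have hS : S = circularPeakSet m τ \ {permToFun m τ i} := by
    rw [h]; ext x; simp only [Finset.mem_sdiff, Finset.mem_union, Finset.mem_singleton]
    constructor
    · intro hx; exact ⟨Or.inl hx, fun e => hj (e ▸ hx)⟩
    · tauto
  have n1 : permToFun m τ (i - 1) ∉ circularPeakSet m τ := by
    rw [mem_cps_s5 m τ _ (by omega), mem_pkPos, Nat.sub_add_cancel (by omega)]; omega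
  have n2 : permToFun m τ (i + 1) ∉ circularPeakSet m τ := by
    rw [mem_cps_s5 m τ _ (by omega), mem_pkPos, Nat.add_sub_cancel]; omega
  have e : goodPos m τ S = {i, i + 1} := by
    ext p
    rw [mem_goodPos, Finset.mem_insert, Finset.mem_singleton]
    constructor
    · rintro ⟨hp, e⟩
      have : permToFun m τ i = permToFun m τ (p - 1) ∨ permToFun m τ i = permToFun m τ p := by
        by_contra hh
        apply hj
        rw [← e]
        simp only [Finset.mem_sdiff, Finset.mem_insert, Finset.mem_singleton]
        exact ⟨hjC, hh⟩
      rcases this with h | h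
      · have := permToFun_inj m τ _ _ (by omega) (by omega) h; omega
      · have := permToFun_inj m τ _ _ (by omega) (by omega) h; omega
    · rintro (rfl | rfl)
      · refine ⟨by omega, ?_⟩
        rw [hS]; ext x
        simp only [Finset.mem_sdiff, Finset.mem_insert, Finset.mem_singleton]
        constructor
        · tauto
        · rintro ⟨h1, h2⟩
          exact ⟨h1, fun h3 => h3.elim (fun e => n1 (e ▸ h1)) h2⟩
      · refine ⟨by omega, ?_⟩
        rw [hS]; ext x
        simp only [Finset.mem_sdiff, Finset.mem_insert, Finset.mem_singleton, Nat.add_sub_cancel]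
        constructor
        · tauto
        · rintro ⟨h1, h2⟩
          exact ⟨h1, fun h3 => h3.elim h2 (fun e => n2 (e ▸ h1))⟩
  rw [e, Finset.card_pair (by omega)]

theorem good_other (m : ℕ) (τ : Equiv.Perm (Fin m)) (S : Finset ℕ)
    (h0 : circularPeakSet m τ ≠ S)
    (h1 : ∀ j ∈ Finset.Icc 1 m \ S, circularPeakSet m τ ≠ S ∪ {j}) :
    (goodPos m τ S).card = 0 := by
  rw [Finset.card_eq_zero, Finset.eq_empty_iff_forall_notMem]
  intro p hp
  rw [mem_goodPos] at hp
  obtain ⟨hp, e⟩ := hp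
  have key : ∀ a b, (b ∉ circularPeakSet m τ) →
      circularPeakSet m τ \ {a, b} = S → False := by
    intro a b hb e
    by_cases ha : a ∈ circularPeakSet m τ
    · refine h1 a (Finset.mem_sdiff.2 ⟨cps_sub m τ ha, ?_⟩) ?_
      · rw [← e]; simp
      · rw [← e]; ext x
        simp only [Finset.mem_sdiff, Finset.mem_insert, Finset.mem_singleton, Finset.mem_union]
        constructor
        · intro hx
          by_cases hxa : x = a
          · exact Or.inr hxa
          · exact Or.inl ⟨hx, fun h => h.elim hxa (fun e => hb (e ▸ hx))⟩
        · rintro (h | rfl)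
          · exact h.1
          · exact ha
    · apply h0
      rw [← e]; symm
      rw [sdiff_eq_left]
      simp [ha, hb]
  by_cases hb : permToFun m τ p ∈ circularPeakSet m τ
  · refine key (permToFun m τ p) (permToFun m τ (p - 1)) ?_ (by rw [Finset.pair_comm]; exact e)
    rw [mem_cps_s5 _ _ _ hp.2, mem_pkPos] at hb
    rw [mem_cps_s5 _ _ _ (by omega), mem_pkPos, Nat.sub_add_cancel (by omega)]
    omega
  · exact key _ _ hb e

theorem good_formula (m : ℕ) (hm : 2 ≤ m) (τ : Equiv.Perm (Fin m)) (S : Finset ℕ) :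
    ((goodPos m τ S).card : ℤ) =
      ((m : ℤ) - 1 - 2 * S.card) * (if circularPeakSet m τ = S then 1 else 0) +
      ∑ j ∈ Finset.Icc 1 m \ S, 2 * (if circularPeakSet m τ = S ∪ {j} then (1 : ℤ) else 0) := by
  by_cases h0 : circularPeakSet m τ = S
  · have h1 := good_eq m hm τ S h0
    rw [if_pos h0, Finset.sum_eq_zero]
    · omega
    · intro j hj
      rw [if_neg, mul_zero]
      intro e
      rw [h0] at e
      apply (Finset.mem_sdiff.1 hj).2
      rw [e]; simp
  · rw [if_neg h0]
    by_cases h1 : ∃ j ∈ Finset.Icc 1 m \ S, circularPeakSet m τ = S ∪ {j}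
    · obtain ⟨j, hj, e⟩ := h1
      have hjS := (Finset.mem_sdiff.1 hj).2
      rw [good_insert m τ S j hjS e, Finset.sum_eq_single j, if_pos e]
      · simp
      · intro k hk hkj
        rw [if_neg, mul_zero]
        intro e'
        have : k ∈ S ∪ {j} := by rw [← e, e']; simp
        rcases Finset.mem_union.1 this with h | h
        · exact (Finset.mem_sdiff.1 hk).2 h
        · exact hkj (Finset.mem_singleton.1 h)
      · exact fun h => absurd hj h
    · push Not at h1
      rw [good_other m τ S h0 h1, Finset.sum_eq_zero]
      · simp
      · intro j hj; rw [if_neg (h1 j hj), mul_zero]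

theorem cp_sum_ite (m : ℕ) (S : Finset ℕ) :
    (cp m S : ℤ) = ∑ τ : Equiv.Perm (Fin m), (if circularPeakSet m τ = S then (1 : ℤ) else 0) := by
  simp [cp, CPperms]

/-- Lemma 3.1: for `n ≥ 3` and `S ⊆ [n-1]`,
`cp_n(S ∪ {n}) = (n - 2 - 2|S|)·cp_{n-1}(S) + Σ_{j ∈ [n-1] \ S} 2·cp_{n-1}(S ∪ {j})`,
as an identity of integers. -/
theorem cp_insert_top_recurrence (n : ℕ) (hn : 3 ≤ n) (S : Finset ℕ)
    (hS : S ⊆ Finset.Icc 1 (n - 1)) :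
    (cp n (S ∪ {n}) : ℤ) =
      ((n : ℤ) - 2 - 2 * S.card) * cp (n - 1) S +
      ∑ j ∈ Finset.Icc 1 (n - 1) \ S, 2 * (cp (n - 1) (S ∪ {j}) : ℤ) := by
  obtain ⟨m, rfl⟩ : ∃ m, n = m + 1 := ⟨n - 1, by omega⟩
  simp only [Nat.add_sub_cancel] at hS ⊢
  rw [cp_eq_sum m S hS]
  push_cast
  simp only [good_formula m (by omega), cp_sum_ite]
  rw [Finset.sum_add_distrib, ← Finset.mul_sum, Finset.sum_comm]
  simp only [Finset.mul_sum]
  congr 1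
  apply Finset.sum_congr rfl
  intro τ _
  ring
end

section
/- Let k ≥ 0 and n ≥ k + 4, and let S ⊆ [3, n−k−1] be such that CP_n(S) ≠ ∅. Then cp_n(S ∪ [n−k+1, n]) = 2(k+1)·cp_{n−1}(S ∪ [n−k, n−1]) + k(k+1)·cp_{n−2}(S ∪ [n−k, n−2]). -/
def pk : List ℕ → Finset ℕ
  | a :: b :: c :: t => (if a < b ∧ c < b then {b} else ∅) ∪ pk (b :: c :: t)
  | _ => ∅

theorem mem_pk (b : ℕ) (l : List ℕ) :
    b ∈ pk l ↔ ∃ u a c w, l = u ++ a :: b :: c :: w ∧ a < b ∧ c < b := by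
  induction l with
  | nil => simp [pk]
  | cons x t ih =>
    have key : (∃ u a c w, x :: t = u ++ a :: b :: c :: w ∧ a < b ∧ c < b) ↔
        (∃ c w, t = b :: c :: w ∧ x < b ∧ c < b) ∨
        (∃ u a c w, t = u ++ a :: b :: c :: w ∧ a < b ∧ c < b) := by
      constructor
      · rintro ⟨u, a, c, w, h, h1, h2⟩
        cases u with
        | nil => simp at h; left; exact ⟨c, w, h.2, h.1 ▸ h1, h2⟩
        | cons y u => simp at h; right; exact ⟨u, a, c, w, h.2, h1, h2⟩
      · rintro (⟨c, w, h, h1, h2⟩ | ⟨u, a, c, w, h, h1, h2⟩)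
        · exact ⟨[], x, c, w, by simp [h], h1, h2⟩
        · exact ⟨x :: u, a, c, w, by simp [h], h1, h2⟩
    rw [key, ← ih]
    match t with
    | [] => simp [pk]
    | [y] => simp [pk]
    | y :: z :: s =>
      rw [pk]
      simp only [Finset.mem_union]
      refine or_congr ?_ Iff.rfl
      split_ifs with h
      · simp only [Finset.mem_singleton, List.cons.injEq]
        constructor
        · rintro rfl; exact ⟨z, s, ⟨rfl, rfl, rfl⟩, h⟩
        · rintro ⟨_, _, ⟨h, _⟩, _⟩; exact h.symm
      · simp only [Finset.notMem_empty, List.cons.injEq, false_iff]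
        rintro ⟨_, _, ⟨rfl, rfl, rfl⟩, h'⟩; exact h h'

theorem pk_reverse (l : List ℕ) : pk l.reverse = pk l := by
  have : ∀ l : List ℕ, pk l ⊆ pk l.reverse := by
    intro l b hb
    rw [mem_pk] at hb ⊢
    obtain ⟨u, a, c, w, rfl, h1, h2⟩ := hb
    exact ⟨w.reverse, c, a, u.reverse, by simp, h2, h1⟩
  apply subset_antisymm
  · simpa using this l.reverse
  · exact this l

theorem pk_sub {b : ℕ} {l : List ℕ} (h : b ∈ pk l) : b ∈ l := by
  rw [mem_pk] at h
  obtain ⟨u, a, c, w, rfl, h1, h2⟩ := h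
  simp

theorem pk_down {x c : ℕ} (w : List ℕ) (h : c < x) : pk (x :: c :: w) = pk (c :: w) := by
  cases w with
  | nil => simp [pk]
  | cons d w => rw [pk, if_neg (by omega)]; simp

theorem pk_app {a x : ℕ} (u w : List ℕ) (h : a < x) :
    pk (u ++ a :: x :: w) = pk (u ++ [a]) ∪ pk (a :: x :: w) := by
  induction u with
  | nil => simp [pk]
  | cons y u ih =>
    match u with
    | [] =>
      simp only [List.nil_append, List.cons_append]
      rw [pk, if_neg (by omega)]; simp [pk]
    | [z] =>
      simp only [List.nil_append, List.cons_append] at ih ⊢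
      rw [pk, ih]; simp [pk]
    | z :: z' :: u =>
      simp only [List.cons_append] at ih ⊢
      rw [pk, ih, pk, Finset.union_assoc]

theorem pk_peak {a x c : ℕ} (u w : List ℕ) (h : a < x) (h' : c < x) :
    pk (u ++ a :: x :: c :: w) = pk (u ++ [a]) ∪ ({x} ∪ pk (c :: w)) := by
  rw [pk_app _ _ h, pk, if_pos ⟨h, h'⟩, pk_down _ h']

theorem pk_nonpeak {a m x c : ℕ} (u w : List ℕ) (h : a < m) (h2 : m < x) (h' : c < x) :
    pk (u ++ a :: m :: x :: c :: w) = pk (u ++ [a]) ∪ ({x} ∪ pk (c :: w)) := by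
  rw [pk_app _ _ h, pk, if_neg (by omega), pk, if_pos ⟨h2, h'⟩, pk_down _ h']; simp

theorem pk_two {a m x y c : ℕ} (u w : List ℕ) (h : a < x) (h1 : m < x) (h2 : m < y) (h' : c < y) :
    pk (u ++ a :: x :: m :: y :: c :: w) = pk (u ++ [a]) ∪ ({x} ∪ ({y} ∪ pk (c :: w))) := by
  rw [pk_peak _ _ h h1, pk, if_pos ⟨h2, h'⟩, pk_down _ h']

theorem split_unique {x : ℕ} {u w u' w' : List ℕ} (hn : (u ++ x :: w).Nodup)
    (h : u ++ x :: w = u' ++ x :: w') : u = u' ∧ w = w' := by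
  induction u generalizing u' with
  | nil =>
    cases u' with
    | nil => simpa using h
    | cons y u' =>
      simp at h hn; obtain ⟨rfl, rfl⟩ := h; simp at hn
  | cons z u ih =>
    cases u' with
    | nil => simp at h hn; obtain ⟨rfl, rfl⟩ := h; simp at hn
    | cons y u' =>
      simp only [List.cons_append, List.cons.injEq, List.nodup_cons] at h hn
      obtain ⟨h1, h2⟩ := ih hn.2 h.2
      exact ⟨by rw [h.1, h1], h2⟩

theorem pk_split {x : ℕ} {u w : List ℕ} (hn : (u ++ x :: w).Nodup) (h : x ∈ pk (u ++ x :: w)) :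
    ∃ u' a c w', u = u' ++ [a] ∧ w = c :: w' ∧ a < x ∧ c < x := by
  rw [mem_pk] at h
  obtain ⟨u', a, c, w', h, h1, h2⟩ := h
  obtain ⟨e1, e2⟩ := split_unique (u' := u' ++ [a]) hn (by simpa using h)
  exact ⟨u', a, c, w', e1, e2, h1, h2⟩

def arr (V T : Finset ℕ) : Finset (List ℕ) :=
  (V.sort (· ≤ ·)).permutations.toFinset.filter (fun l => pk l = T)

theorem mem_arr {V T : Finset ℕ} {l : List ℕ} :
    l ∈ arr V T ↔ l.Nodup ∧ (∀ x, x ∈ l ↔ x ∈ V) ∧ pk l = T := by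
  simp only [arr, Finset.mem_filter, List.mem_toFinset, List.mem_permutations, ← and_assoc]
  refine and_congr ?_ Iff.rfl
  constructor
  · intro h
    exact ⟨h.nodup_iff.2 (Finset.sort_nodup _ _), fun x => by rw [h.mem_iff]; simp⟩
  · rintro ⟨h1, h2⟩
    rw [List.perm_ext_iff_of_nodup h1 (Finset.sort_nodup _ _)]
    simpa using h2

theorem pk_map {f : ℕ → ℕ} (hf : StrictMono f) (l : List ℕ) : pk (l.map f) = (pk l).image f := by
  induction l with
  | nil => simp [pk]
  | cons x t ih =>
    match t with
    | [] => simp [pk]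
    | [y] => simp [pk]
    | y :: z :: s =>
      simp only [List.map_cons] at ih ⊢
      rw [pk, pk, ih, Finset.image_union]
      simp only [hf.lt_iff_lt]
      split_ifs <;> simp

theorem arr_map {f : ℕ → ℕ} (hf : StrictMono f) (V T : Finset ℕ) :
    (arr (V.image f) (T.image f)).card = (arr V T).card := by
  symm
  apply Finset.card_bij (fun l _ => l.map f)
  · intro l hl
    rw [mem_arr] at hl ⊢
    obtain ⟨h1, h2, h3⟩ := hl
    refine ⟨h1.map hf.injective, ?_, by rw [pk_map hf, h3]⟩
    intro x; simp [h2]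
  · intro l _ l' _ h
    exact List.map_injective_iff.2 hf.injective h
  · intro l hl
    rw [mem_arr] at hl
    obtain ⟨h1, h2, h3⟩ := hl
    have : ∃ l0 : List ℕ, l0.map f = l := by
      have : l ∈ Set.range (List.map f) := by
        rw [Set.range_list_map]
        intro x hx
        have := (h2 x).1 hx
        simp at this
        obtain ⟨a, _, rfl⟩ := this
        simp
      exact this
    obtain ⟨l0, rfl⟩ := this
    refine ⟨l0, ?_, rfl⟩
    rw [mem_arr]
    refine ⟨h1.of_map, fun x => ?_, ?_⟩
    · have := h2 (f x)
      simpa [hf.injective.eq_iff] using this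
    · rw [pk_map hf] at h3
      exact Finset.image_injective hf.injective h3

def rn (m : ℕ) : List ℕ → ℕ
  | [] => 0
  | a :: t => if a = m then t.headD 0 else rn m t

theorem rn_split {m : ℕ} (u w : List ℕ) (h : (u ++ m :: w).Nodup) :
    rn m (u ++ m :: w) = w.headD 0 := by
  induction u with
  | nil => simp [rn]
  | cons a u ih =>
    simp only [List.cons_append, List.nodup_cons] at h
    rw [List.cons_append, rn, if_neg, ih h.2]
    rintro rfl
    simp at h

def cl (m z : ℕ) : ℕ := if z = 0 then 0 else if z < m then 1 else z

/-- permutations -/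
theorem pk_getD (l : List ℕ) (b : ℕ) : b ∈ pk l ↔ ∃ i, i + 2 < l.length ∧
    l.getD i 0 < l.getD (i+1) 0 ∧ l.getD (i+2) 0 < l.getD (i+1) 0 ∧ l.getD (i+1) 0 = b := by
  induction l with
  | nil => simp [pk]
  | cons x t ih =>
    match t with
    | [] => simp [pk]
    | [y] => simp [pk]
    | y :: z :: s =>
      rw [pk, Finset.mem_union, ih]
      constructor
      · rintro (h | ⟨i, h1, h2⟩)
        · split_ifs at h with h'
          · simp at h; subst h
            exact ⟨0, by simp, by simpa using h'⟩
          · simp at h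
        · refine ⟨i+1, by simp at h1 ⊢; omega, ?_⟩
          simpa using h2
      · rintro ⟨i, h1, h2⟩
        cases i with
        | zero =>
          left
          simp at h2
          rw [if_pos ⟨h2.1, h2.2.1⟩]; simp [h2.2.2]
        | succ i =>
          right
          refine ⟨i, by simp at h1 ⊢; omega, ?_⟩
          simpa using h2

theorem getD_ofFn (n : ℕ) (σ : Equiv.Perm (Fin n)) (j : ℕ) :
    (List.ofFn (fun i => (σ i : ℕ) + 1)).getD j 0 = permToFun n σ j := by
  unfold permToFun
  split_ifs with h
  · simp [List.getD, h]
  · simp [List.getD, h]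

theorem pk_ofFn (n : ℕ) (σ : Equiv.Perm (Fin n)) :
    pk (List.ofFn (fun i => (σ i : ℕ) + 1)) = circularPeakSet n σ := by
  ext b
  rw [pk_getD]
  simp only [getD_ofFn, List.length_ofFn, circularPeakSet, Finset.mem_image, Finset.mem_filter,
    Finset.mem_Ioo]
  constructor
  · rintro ⟨i, h, h1, h2, h3⟩
    exact ⟨i+1, ⟨⟨by omega, by omega⟩, by simpa using h1, h2⟩, h3⟩
  · rintro ⟨j, ⟨⟨h, h'⟩, h1, h2⟩, h3⟩
    obtain ⟨i, rfl⟩ : ∃ i, j = i + 1 := ⟨j-1, by omega⟩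
    exact ⟨i, by omega, by simpa using h1, h2, h3⟩

theorem cp_eq (n : ℕ) (T : Finset ℕ) : cp n T = (arr (Finset.Icc 1 n) T).card := by
  unfold cp
  apply Finset.card_bij (fun σ _ => List.ofFn (fun i => (σ i : ℕ) + 1))
  · intro σ hσ
    simp only [CPperms, Finset.mem_filter, Finset.mem_univ, true_and] at hσ
    rw [mem_arr, pk_ofFn]
    refine ⟨?_, ?_, hσ⟩
    · rw [List.nodup_ofFn]
      intro i j h
      simp at h
      exact σ.injective (Fin.ext h)
    · intro x
      simp only [List.mem_ofFn, Set.mem_range, Finset.mem_Icc]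
      constructor
      · rintro ⟨i, rfl⟩
        have := (σ i).2
        omega
      · rintro ⟨h1, h2⟩
        exact ⟨σ.symm ⟨x-1, by omega⟩, by simp; omega⟩
  · intro σ _ τ _ h
    rw [List.ofFn_inj] at h
    ext i
    have := congrFun h i
    simpa using this
  · intro l hl
    rw [mem_arr] at hl
    obtain ⟨h1, h2, h3⟩ := hl
    have hlen : l.length = n := by
      rw [← List.toFinset_card_of_nodup h1]
      have : l.toFinset = Finset.Icc 1 n := by ext x; simp [h2]
      rw [this]; simp
    have hb : ∀ i : Fin n, 1 ≤ l[(i:ℕ)]'(by omega) ∧ l[(i:ℕ)]'(by omega) ≤ n := fun i =>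
      Finset.mem_Icc.1 ((h2 _).1 (List.getElem_mem _))
    let f : Fin n → Fin n := fun i => ⟨l[(i:ℕ)]'(by omega) - 1, by have := hb i; omega⟩
    have hf : Function.Injective f := by
      intro i j h
      have h : l[(i:ℕ)]'(by omega) - 1 = l[(j:ℕ)]'(by omega) - 1 := congrArg Fin.val h
      have := hb i
      have := hb j
      have h : l[(i:ℕ)]'(by omega) = l[(j:ℕ)]'(by omega) := by omega
      rw [h1.getElem_inj_iff] at h
      exact Fin.ext h
    have hl : List.ofFn (fun i => (Equiv.ofBijective f (Finite.injective_iff_bijective.1 hf) i : ℕ) + 1) = l := by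
      apply List.ext_getElem
      · simp [hlen]
      · intro i hi hi'
        simp only [List.getElem_ofFn, Equiv.ofBijective_apply, f]
        have := hb ⟨i, by omega⟩
        simp only at this
        omega
    refine ⟨Equiv.ofBijective f (Finite.injective_iff_bijective.1 hf), ?_, hl⟩
    simp only [CPperms, Finset.mem_filter, Finset.mem_univ, true_and]
    rw [← pk_ofFn, hl, h3]
theorem er {m : ℕ} {u w : List ℕ} (h : (u ++ m :: w).Nodup) : (u ++ m :: w).erase m = u ++ w := by
  rw [List.erase_append_right, List.erase_cons_head]
  intro hm
  rw [List.nodup_append] at h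
  exact h.2.2 m hm m (by simp) rfl

theorem arr_iff1 {m : ℕ} {V T : Finset ℕ} {l l' : List ℕ} (hp : l.Perm (m :: l'))
    (hk : pk l = pk l') (hm : m ∈ V) : l ∈ arr V T ↔ l' ∈ arr (V.erase m) T := by
  rw [mem_arr, mem_arr, hp.nodup_iff, hk, List.nodup_cons]
  simp only [hp.mem_iff, List.mem_cons, Finset.mem_erase]
  constructor
  · rintro ⟨⟨h1, h2⟩, h3, h4⟩
    refine ⟨h2, fun x => ?_, h4⟩
    rw [← h3]
    constructor
    · intro h; exact ⟨fun e => h1 (e ▸ h), Or.inr h⟩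
    · rintro ⟨h, h'⟩; tauto
  · rintro ⟨h1, h2, h3⟩
    refine ⟨⟨by simp [h2], h1⟩, fun x => ?_, h3⟩
    rw [h2]
    by_cases e : x = m
    · simp [e, hm]
    · simp [e]

theorem arr_iff2 {m x : ℕ} {V T : Finset ℕ} {l l' : List ℕ} (hp : l.Perm (m :: x :: l'))
    (hk : pk l = insert x (pk l')) (hm : m ∈ V) (hx : x ∈ V) (hxm : x ≠ m) (hT : x ∈ T) :
    l ∈ arr V T ↔ l' ∈ arr ((V.erase m).erase x) (T.erase x) := by
  have hx' : x ∉ l' → x ∉ pk l' := fun h h' => h (pk_sub h')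
  have hT' : x ∉ l' → (insert x (pk l') = T ↔ pk l' = T.erase x) := by
    intro h
    constructor
    · rintro rfl; rw [Finset.erase_insert (hx' h)]
    · intro e; rw [e, Finset.insert_erase hT]
  rw [mem_arr, mem_arr, hp.nodup_iff, hk, List.nodup_cons, List.nodup_cons]
  simp only [hp.mem_iff, List.mem_cons, Finset.mem_erase]
  constructor
  · rintro ⟨⟨h1, h2, h5⟩, h3, h4⟩
    refine ⟨h5, fun z => ?_, (hT' h2).1 h4⟩
    rw [← h3]
    constructor
    · intro h
      exact ⟨fun e => h2 (e ▸ h), fun e => h1 (Or.inr (e ▸ h)), Or.inr (Or.inr h)⟩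
    · rintro ⟨h, h', h''⟩; tauto
  · rintro ⟨h1, h2, h3⟩
    have hxl : x ∉ l' := by simp [h2]
    refine ⟨⟨by simp [h2, hxm.symm], hxl, h1⟩, fun z => ?_, (hT' hxl).2 h3⟩
    rw [h2]
    by_cases e : z = m
    · simp [e, hm]
    · by_cases e' : z = x
      · simp [e', hx]
      · simp [e, e']

def fib (m : ℕ) (V T : Finset ℕ) (a b : ℕ) : Finset (List ℕ) :=
  (arr V T).filter (fun l => cl m (rn m l.reverse) = a ∧ cl m (rn m l) = b)

structure Ctx (m : ℕ) (V S K : Finset ℕ) : Prop where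
  hm : m ∈ V
  hm2 : 2 ≤ m
  hK : ∀ x ∈ K, m < x
  hKV : ∀ x ∈ K, x ∈ V
  hV : ∀ v ∈ V, v ≠ m → v ∉ K → v < m
  h0 : 0 ∉ V
  hS : ∀ s ∈ S, s < m
  hne : ∃ v ∈ V, v < m

theorem fib_symm (m : ℕ) (V T : Finset ℕ) (a b : ℕ) : (fib m V T a b).card = (fib m V T b a).card := by
  have key : ∀ l, l ∈ arr V T → l.reverse ∈ arr V T := by
    intro l hl
    rw [mem_arr] at hl ⊢
    simpa [pk_reverse] using hl
  apply Finset.card_bij (fun l _ => l.reverse)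
  · intro l hl
    simp only [fib, Finset.mem_filter] at hl ⊢
    simp only [List.reverse_reverse]
    exact ⟨key l hl.1, hl.2.2, hl.2.1⟩
  · intro l _ l' _ h
    simpa using h
  · intro l hl
    refine ⟨l.reverse, ?_, by simp⟩
    simp only [fib, Finset.mem_filter] at hl ⊢
    simp only [List.reverse_reverse]
    exact ⟨key l hl.1, hl.2.2, hl.2.1⟩

theorem mem_fib {m a b : ℕ} {V T : Finset ℕ} (hm : m ∈ V) {l : List ℕ} :
    l ∈ fib m V T a b ↔ l ∈ arr V T ∧ ∃ u w, l = u ++ m :: w ∧ cl m (u.reverse.headD 0) = a ∧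
      cl m (w.headD 0) = b := by
  have key : ∀ u w, (u ++ m :: w).Nodup → rn m (u ++ m :: w).reverse = u.reverse.headD 0 := by
    intro u w h
    rw [← List.nodup_reverse] at h
    have e : (u ++ m :: w).reverse = w.reverse ++ m :: u.reverse := by simp
    rw [e] at h ⊢
    exact rn_split _ _ h
  simp only [fib, Finset.mem_filter]
  refine and_congr_right fun hl => ?_
  rw [mem_arr] at hl
  obtain ⟨h1, h2, -⟩ := hl
  constructor
  · intro h
    obtain ⟨u, w, rfl⟩ := List.append_of_mem ((h2 m).2 hm)
    rw [key _ _ h1, rn_split _ _ h1] at h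
    exact ⟨u, w, rfl, h⟩
  · rintro ⟨u, w, rfl, h⟩
    rw [key _ _ h1, rn_split _ _ h1]
    exact h

theorem cl0 {m : ℕ} {l : List ℕ} (hm2 : 2 ≤ m) (h0 : 0 ∉ l) : cl m (l.headD 0) = 0 ↔ l = [] := by
  cases l with
  | nil => simp [cl]
  | cons a t =>
    simp at h0
    rw [List.headD_cons]; unfold cl
    split_ifs <;> simp <;> omega

theorem cl1 {m : ℕ} {l : List ℕ} (hm2 : 2 ≤ m) (h0 : 0 ∉ l) : cl m (l.headD 0) = 1 ↔
    ∃ a t, l = a :: t ∧ a < m := by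
  cases l with
  | nil => simp [cl]
  | cons a t =>
    simp at h0
    rw [List.headD_cons]; unfold cl
    split_ifs <;> simp <;> omega

theorem clx {m x : ℕ} {l : List ℕ} (hm2 : 2 ≤ m) (hx : m < x) : cl m (l.headD 0) = x ↔
    ∃ t, l = x :: t := by
  cases l with
  | nil => simp [cl]; omega
  | cons a t =>
    rw [List.headD_cons]; unfold cl
    split_ifs <;> simp <;> omega

section
variable {m : ℕ} {V S K : Finset ℕ} (C : Ctx m V S K)
include C

theorem Ctx.zero {l : List ℕ} (hl : l ∈ arr V (S ∪ K)) : 0 ∉ l := by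
  rw [mem_arr] at hl
  rw [hl.2.1]; exact C.h0

theorem Ctx.top {x : ℕ} {u w : List ℕ} {T' V' : Finset ℕ} (hl : u ++ x :: w ∈ arr V' T') (hx : x ∈ T') :
    ∃ u' a c w', u = u' ++ [a] ∧ w = c :: w' ∧ a < x ∧ c < x := by
  rw [mem_arr] at hl
  exact pk_split hl.1 (by rw [hl.2.2]; exact hx)

theorem Ctx.F01 {l : List ℕ} : l ∈ fib m V (S ∪ K) 0 1 ↔
    ∃ c w, l = m :: c :: w ∧ c < m ∧ l ∈ arr V (S ∪ K) := by
  rw [mem_fib C.hm]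
  constructor
  · rintro ⟨hl, u, w, rfl, h1, h2⟩
    have h0 := C.zero hl
    simp at h0
    rw [cl0 C.hm2 (by simp [h0])] at h1
    rw [cl1 C.hm2 (by simp [h0])] at h2
    obtain ⟨c, w, rfl, hc⟩ := h2
    simp at h1; subst h1
    exact ⟨c, w, rfl, hc, hl⟩
  · rintro ⟨c, w, rfl, hc, hl⟩
    have h0 := C.zero hl
    simp at h0
    refine ⟨hl, [], c :: w, rfl, by simp [cl], ?_⟩
    rw [cl1 C.hm2 (by simp [h0])]
    exact ⟨c, w, rfl, hc⟩

theorem Ctx.F0x {l : List ℕ} {x : ℕ} (hx : x ∈ K) : l ∈ fib m V (S ∪ K) 0 x ↔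
    ∃ c w, l = m :: x :: c :: w ∧ c < x ∧ l ∈ arr V (S ∪ K) := by
  rw [mem_fib C.hm]
  constructor
  · rintro ⟨hl, u, w, rfl, h1, h2⟩
    have h0 := C.zero hl
    simp at h0
    rw [cl0 C.hm2 (by simp [h0])] at h1
    rw [clx C.hm2 (C.hK x hx)] at h2
    obtain ⟨w, rfl⟩ := h2
    simp at h1; subst h1
    obtain ⟨u', a, c, w', h1, rfl, h2, h3⟩ := C.top (u := [m]) (x := x) hl (by simp [hx])
    exact ⟨c, w', rfl, h3, hl⟩
  · rintro ⟨c, w, rfl, hc, hl⟩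
    refine ⟨hl, [], x :: c :: w, rfl, by simp [cl], ?_⟩
    rw [clx C.hm2 (C.hK x hx)]
    exact ⟨c :: w, rfl⟩

theorem Ctx.F1x {l : List ℕ} {x : ℕ} (hx : x ∈ K) : l ∈ fib m V (S ∪ K) 1 x ↔
    ∃ u a c w, l = u ++ a :: m :: x :: c :: w ∧ a < m ∧ c < x ∧ l ∈ arr V (S ∪ K) := by
  rw [mem_fib C.hm]
  constructor
  · rintro ⟨hl, u, w, rfl, h1, h2⟩
    have h0 := C.zero hl
    simp at h0
    rw [cl1 C.hm2 (by simp [h0])] at h1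
    rw [clx C.hm2 (C.hK x hx)] at h2
    obtain ⟨w, rfl⟩ := h2
    obtain ⟨a, u, h1, ha⟩ := h1
    rw [List.reverse_eq_iff] at h1
    simp at h1; subst h1
    obtain ⟨u', a', c, w', h1, rfl, h2, h3⟩ := C.top (u := u.reverse ++ [a] ++ [m]) (x := x) (w := w)
      (by simpa using hl) (by simp [hx])
    exact ⟨u.reverse, a, c, w', by simp, ha, h3, hl⟩
  · rintro ⟨u, a, c, w, rfl, ha, hc, hl⟩
    have h0 := C.zero hl
    simp at h0
    refine ⟨hl, u ++ [a], x :: c :: w, by simp, ?_, ?_⟩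
    · rw [cl1 C.hm2 (by simp [h0])]
      exact ⟨a, u.reverse, by simp, ha⟩
    · rw [clx C.hm2 (C.hK x hx)]
      exact ⟨c :: w, rfl⟩

theorem Ctx.Fxy {l : List ℕ} {x y : ℕ} (hx : x ∈ K) (hy : y ∈ K) : l ∈ fib m V (S ∪ K) x y ↔
    ∃ u a c w, l = u ++ a :: x :: m :: y :: c :: w ∧ a < x ∧ c < y ∧ l ∈ arr V (S ∪ K) := by
  rw [mem_fib C.hm]
  constructor
  · rintro ⟨hl, u, w, rfl, h1, h2⟩
    rw [clx C.hm2 (C.hK x hx)] at h1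
    rw [clx C.hm2 (C.hK y hy)] at h2
    obtain ⟨w, rfl⟩ := h2
    obtain ⟨u, h1⟩ := h1
    rw [List.reverse_eq_iff] at h1
    simp at h1; subst h1
    obtain ⟨_, _, c, w', h1, rfl, h2, h3⟩ := C.top (u := u.reverse ++ [x] ++ [m]) (x := y) (w := w)
      (by simpa using hl) (by simp [hy])
    obtain ⟨u', a, _, _, h1', _, h2', h3'⟩ := C.top (u := u.reverse) (x := x)
      (by simpa using hl) (by simp [hx])
    rw [h1'] at hl ⊢
    exact ⟨u', a, c, w', by simp, h2', h3, hl⟩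
  · rintro ⟨u, a, c, w, rfl, ha, hc, hl⟩
    refine ⟨hl, u ++ [a] ++ [x], y :: c :: w, by simp, ?_, ?_⟩
    · rw [clx C.hm2 (C.hK x hx)]
      exact ⟨a :: u.reverse, by simp⟩
    · rw [clx C.hm2 (C.hK y hy)]
      exact ⟨c :: w, rfl⟩

theorem Ctx.c00 : (fib m V (S ∪ K) 0 0).card = 0 := by
  rw [Finset.card_eq_zero, Finset.eq_empty_iff_forall_notMem]
  intro l h
  rw [mem_fib C.hm] at h
  obtain ⟨hl, u, w, rfl, h1, h2⟩ := h
  have h0 := C.zero hl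
  simp at h0
  rw [cl0 C.hm2 (by simp [h0])] at h1 h2
  simp at h1; subst h1 h2
  obtain ⟨v, hv, hv'⟩ := C.hne
  rw [mem_arr] at hl
  have := (hl.2.1 v).2 hv
  simp at this
  omega

theorem Ctx.mT : m ∉ S ∪ K := by
  intro h
  rcases Finset.mem_union.1 h with h | h
  · exact absurd (C.hS m h) (by omega)
  · exact absurd (C.hK m h) (by omega)

theorem Ctx.c11 : (fib m V (S ∪ K) 1 1).card = 0 := by
  rw [Finset.card_eq_zero, Finset.eq_empty_iff_forall_notMem]
  intro l h
  rw [mem_fib C.hm] at h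
  obtain ⟨hl, u, w, rfl, h1, h2⟩ := h
  have h0 := C.zero hl
  simp at h0
  rw [cl1 C.hm2 (by simp [h0])] at h1 h2
  obtain ⟨a, u, h1, ha⟩ := h1
  rw [List.reverse_eq_iff] at h1
  simp at h1; subst h1
  obtain ⟨c, w, rfl, hc⟩ := h2
  rw [mem_arr] at hl
  apply C.mT
  rw [← hl.2.2, mem_pk]
  exact ⟨u.reverse, a, c, w, by simp, ha, hc⟩

theorem Ctx.cxx {x : ℕ} (hx : x ∈ K) : (fib m V (S ∪ K) x x).card = 0 := by
  rw [Finset.card_eq_zero, Finset.eq_empty_iff_forall_notMem]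
  intro l h
  rw [C.Fxy hx hx] at h
  obtain ⟨u, a, c, w, rfl, ha, hc, hl⟩ := h
  rw [mem_arr] at hl
  have := hl.1
  simp [List.nodup_append] at this

theorem Ctx.c01 : (fib m V (S ∪ K) 0 1).card = (arr (V.erase m) (S ∪ K)).card := by
  apply Finset.card_bij (fun l _ => l.erase m)
  · intro l hl
    obtain ⟨c, w, rfl, hc, hl⟩ := C.F01.1 hl
    rw [List.erase_cons_head]
    rwa [← arr_iff1 (List.Perm.refl _) (pk_down _ hc) C.hm]
  · intro l hl l' hl' h
    obtain ⟨c, w, rfl, hc, hl⟩ := C.F01.1 hl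
    obtain ⟨c', w', rfl, hc', hl'⟩ := C.F01.1 hl'
    rw [List.erase_cons_head, List.erase_cons_head] at h
    rw [h]
  · intro l hl
    refine ⟨m :: l, ?_, by simp⟩
    rw [C.F01]
    have hl' := hl
    rw [mem_arr] at hl'
    cases l with
    | nil =>
      obtain ⟨v, hv, hv'⟩ := C.hne
      have := (hl'.2.1 v).2 (by simp [hv]; omega)
      simp at this
    | cons c w =>
      have h1 := (hl'.2.1 c).1 (by simp)
      rw [Finset.mem_erase] at h1
      have hc : c < m := by
        apply C.hV c h1.2 h1.1
        intro hK
        obtain ⟨u, _, _, _, h, _⟩ := C.top (u := []) (w := w) (x := c) hl (by simp [hK])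
        simp at h
      refine ⟨c, w, rfl, hc, ?_⟩
      rwa [arr_iff1 (List.Perm.refl _) (pk_down _ hc) C.hm]

theorem Ctx.c1x {x : ℕ} (hx : x ∈ K) :
    (fib m V (S ∪ K) 1 x).card = (arr (V.erase m) (S ∪ K)).card := by
  have hmx := C.hK x hx
  have per : ∀ (u : List ℕ) a c w, (u ++ a :: m :: x :: c :: w).Perm (m :: (u ++ a :: x :: c :: w)) := by
    intro u a c w
    have := List.perm_middle (a := m) (l₁ := u ++ [a]) (l₂ := x :: c :: w)
    simpa using this
  have ere : ∀ (u : List ℕ) a c w, (u ++ a :: m :: x :: c :: w) ∈ arr V (S ∪ K) →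
      (u ++ a :: m :: x :: c :: w).erase m = (u ++ a :: x :: c :: w) := by
    intro u a c w h
    have := er (m := m) (u := u ++ [a]) (w := x :: c :: w) (by simpa using (mem_arr.1 h).1)
    simpa using this
  have pkk : ∀ (u : List ℕ) a c w, a < m → c < x →
      pk (u ++ a :: m :: x :: c :: w) = pk (u ++ a :: x :: c :: w) := by
    intro u a c w h1 h2
    rw [pk_nonpeak _ _ h1 hmx h2, pk_peak _ _ (h1.trans hmx) h2]
  apply Finset.card_bij (fun l _ => l.erase m)
  · intro l hl
    obtain ⟨u, a, c, w, rfl, ha, hc, hl⟩ := (C.F1x hx).1 hl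
    rw [ere _ _ _ _ hl]
    rwa [← arr_iff1 (per _ _ _ _) (pkk _ _ _ _ ha hc) C.hm]
  · intro l hl l' hl' h
    obtain ⟨u, a, c, w, rfl, ha, hc, hl⟩ := (C.F1x hx).1 hl
    obtain ⟨u', a', c', w', rfl, ha', hc', hl'⟩ := (C.F1x hx).1 hl'
    rw [ere _ _ _ _ hl, ere _ _ _ _ hl'] at h
    rw [arr_iff1 (per _ _ _ _) (pkk _ _ _ _ ha hc) C.hm, mem_arr] at hl
    obtain ⟨e1, e2⟩ := split_unique (x := x) (u := u ++ [a]) (u' := u' ++ [a']) (w := c :: w)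
      (w' := c' :: w') (by simpa using hl.1) (by simpa using h)
    have : (u ++ [a]) ++ m :: x :: (c :: w) = (u' ++ [a']) ++ m :: x :: (c' :: w') := by rw [e1, e2]
    simpa using this
  · intro l hl
    have hxl : x ∈ l := by
      rw [(mem_arr.1 hl).2.1]; simp [C.hKV x hx]; omega
    obtain ⟨u, w, rfl⟩ := List.append_of_mem hxl
    obtain ⟨u, a, c, w, rfl, rfl, ha, hc⟩ := C.top hl (by simp [hx])
    simp only [List.append_assoc, List.cons_append, List.nil_append] at hl ⊢
    have ham : a < m := by
      have h1 := ((mem_arr.1 hl).2.1 a).1 (by simp)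
      rw [Finset.mem_erase] at h1
      apply C.hV a h1.2 h1.1
      intro hK
      obtain ⟨_, _, _, _, _, h, _, h'⟩ := C.top (u := u) (w := x :: c :: w) (x := a) hl (by simp [hK])
      simp at h; omega
    have hl2 := (arr_iff1 (per _ _ _ _) (pkk u a c w ham hc) C.hm).2 hl
    exact ⟨u ++ a :: m :: x :: c :: w, (C.F1x hx).2 ⟨u, a, c, w, rfl, ham, hc, hl2⟩, ere _ _ _ _ hl2⟩

theorem Ctx.c0x {x : ℕ} (hx : x ∈ K) :
    (fib m V (S ∪ K) 0 x).card = (arr ((V.erase m).erase x) ((S ∪ K).erase x)).card := by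
  have hmx := C.hK x hx
  have pkk : ∀ c w, c < x → pk (m :: x :: c :: w) = insert x (pk (c :: w)) := by
    intro c w h
    rw [pk, if_pos ⟨hmx, h⟩, pk_down _ h]; rfl
  have iff : ∀ c w, c < x → (m :: x :: c :: w ∈ arr V (S ∪ K) ↔ 
      c :: w ∈ arr ((V.erase m).erase x) ((S ∪ K).erase x)) := fun c w h =>
    arr_iff2 (List.Perm.refl _) (pkk c w h) C.hm (C.hKV x hx) (by omega) (by simp [hx])
  apply Finset.card_bij (fun l _ => (l.erase m).erase x)
  · intro l hl
    obtain ⟨c, w, rfl, hc, hl⟩ := (C.F0x hx).1 hl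
    rw [List.erase_cons_head, List.erase_cons_head]
    rwa [← iff c w hc]
  · intro l hl l' hl' h
    obtain ⟨c, w, rfl, hc, hl⟩ := (C.F0x hx).1 hl
    obtain ⟨c', w', rfl, hc', hl'⟩ := (C.F0x hx).1 hl'
    simp only [List.erase_cons_head] at h
    rw [h]
  · intro l hl
    refine ⟨m :: x :: l, ?_, by simp⟩
    rw [C.F0x hx]
    have hl' := hl
    rw [mem_arr] at hl'
    cases l with
    | nil =>
      obtain ⟨v, hv, hv'⟩ := C.hne
      have := (hl'.2.1 v).2 (by simp [hv]; omega)
      simp at this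
    | cons c w =>
      have h1 := (hl'.2.1 c).1 (by simp)
      rw [Finset.mem_erase, Finset.mem_erase] at h1
      have hc : c < m := by
        apply C.hV c h1.2.2 h1.2.1
        intro hK
        obtain ⟨u, _, _, _, h, _⟩ := C.top (u := []) (w := w) (x := c) hl (by simp [hK, h1.1])
        simp at h
      exact ⟨c, w, rfl, by omega, (iff c w (by omega)).2 hl⟩

theorem Ctx.cxy {x y : ℕ} (hx : x ∈ K) (hy : y ∈ K) (hxy : x ≠ y) :
    (fib m V (S ∪ K) x y).card = (arr ((V.erase m).erase x) ((S ∪ K).erase x)).card := by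
  have hmx := C.hK x hx
  have hmy := C.hK y hy
  have per : ∀ (u : List ℕ) a c w,
      (u ++ a :: x :: m :: y :: c :: w).Perm (m :: x :: (u ++ a :: y :: c :: w)) := by
    intro u a c w
    have h1 := List.perm_middle (a := m) (l₁ := u ++ [a, x]) (l₂ := y :: c :: w)
    have h2 := List.perm_middle (a := x) (l₁ := u ++ [a]) (l₂ := y :: c :: w)
    simp only [List.append_assoc, List.cons_append, List.nil_append] at h1 h2
    exact h1.trans (h2.cons m)
  have ere : ∀ (u : List ℕ) a c w, (u ++ a :: x :: m :: y :: c :: w) ∈ arr V (S ∪ K) →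
      ((u ++ a :: x :: m :: y :: c :: w).erase m).erase x = (u ++ a :: y :: c :: w) := by
    intro u a c w h
    have hn := (mem_arr.1 h).1
    have h1 := er (m := m) (u := u ++ [a, x]) (w := y :: c :: w) (by simpa using hn)
    have hn2 := hn.erase m
    simp only [List.append_assoc, List.cons_append, List.nil_append] at h1
    rw [h1] at hn2 ⊢
    have h2 := er (m := x) (u := u ++ [a]) (w := y :: c :: w) (by simpa using hn2)
    simpa using h2
  have pkk : ∀ (u : List ℕ) a c w, a < x → a < y → c < y →
      pk (u ++ a :: x :: m :: y :: c :: w) = insert x (pk (u ++ a :: y :: c :: w)) := by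
    intro u a c w h1 h2 h3
    rw [pk_two _ _ h1 hmx hmy h3, pk_peak _ _ h2 h3]
    ext z; simp; tauto
  have iff : ∀ (u : List ℕ) a c w, a < x → a < y → c < y →
      (u ++ a :: x :: m :: y :: c :: w ∈ arr V (S ∪ K) ↔ 
      u ++ a :: y :: c :: w ∈ arr ((V.erase m).erase x) ((S ∪ K).erase x)) :=
    fun u a c w h1 h2 h3 => arr_iff2 (per _ _ _ _) (pkk u a c w h1 h2 h3) C.hm (C.hKV x hx)
      (by omega) (by simp [hx])
  have small : ∀ (u : List ℕ) a c w, a < x → (u ++ a :: x :: m :: y :: c :: w) ∈ arr V (S ∪ K) →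
      a < m := by
    intro u a c w ha hl
    have hn := (mem_arr.1 hl).1
    have h1 := ((mem_arr.1 hl).2.1 a).1 (by simp)
    apply C.hV a h1
    · rintro rfl
      simp [List.nodup_append] at hn
    · intro hK
      obtain ⟨_, _, _, _, _, h, _, h'⟩ := C.top (u := u) (w := x :: m :: y :: c :: w) (x := a) hl
        (by simp [hK])
      simp at h; omega
  apply Finset.card_bij (fun l _ => (l.erase m).erase x)
  · intro l hl
    obtain ⟨u, a, c, w, rfl, ha, hc, hl⟩ := (C.Fxy hx hy).1 hl
    have := small _ _ _ _ ha hl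
    rw [ere _ _ _ _ hl]
    rwa [← iff _ _ _ _ ha (by omega) hc]
  · intro l hl l' hl' h
    obtain ⟨u, a, c, w, rfl, ha, hc, hl⟩ := (C.Fxy hx hy).1 hl
    obtain ⟨u', a', c', w', rfl, ha', hc', hl'⟩ := (C.Fxy hx hy).1 hl'
    have := small _ _ _ _ ha hl
    rw [ere _ _ _ _ hl, ere _ _ _ _ hl'] at h
    rw [iff _ _ _ _ ha (by omega) hc, mem_arr] at hl
    obtain ⟨e1, e2⟩ := split_unique (x := y) (u := u ++ [a]) (u' := u' ++ [a']) (w := c :: w)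
      (w' := c' :: w') (by simpa using hl.1) (by simpa using h)
    have : (u ++ [a]) ++ x :: m :: y :: (c :: w) = (u' ++ [a']) ++ x :: m :: y :: (c' :: w') := by
      rw [e1, e2]
    simpa using this
  · intro l hl
    have hyl : y ∈ l := by
      rw [(mem_arr.1 hl).2.1]; simp [C.hKV y hy]; omega
    obtain ⟨u, w, rfl⟩ := List.append_of_mem hyl
    obtain ⟨u, a, c, w, rfl, rfl, ha, hc⟩ := C.top hl (by simp [hy]; omega)
    simp only [List.append_assoc, List.cons_append, List.nil_append] at hl ⊢
    have ham : a < m := by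
      have h1 := ((mem_arr.1 hl).2.1 a).1 (by simp)
      rw [Finset.mem_erase, Finset.mem_erase] at h1
      apply C.hV a h1.2.2 h1.2.1
      intro hK
      obtain ⟨_, _, _, _, _, h, _, h'⟩ := C.top (u := u) (w := y :: c :: w) (x := a) hl
        (by simp [hK, h1.1])
      simp at h; omega
    have hl2 := (iff u a c w (by omega) ha hc).2 hl
    exact ⟨u ++ a :: x :: m :: y :: c :: w,
      (C.Fxy hx hy).2 ⟨u, a, c, w, rfl, by omega, hc, hl2⟩, ere _ _ _ _ hl2⟩

theorem Ctx.main (N1 N2 : ℕ) (h1 : (arr (V.erase m) (S ∪ K)).card = N1)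
    (h2 : ∀ x ∈ K, (arr ((V.erase m).erase x) ((S ∪ K).erase x)).card = N2) :
    (arr V (S ∪ K)).card = 2 * (K.card + 1) * N1 + K.card * (K.card + 1) * N2 := by
  have hm2 := C.hm2
  have z1 : 1 ∉ K := fun h => by have := C.hK 1 h; omega
  have z0 : 0 ∉ insert 1 K := by
    simp; intro h; have := C.hK 0 h; omega
  have hR : ∀ l ∈ arr V (S ∪ K), ∀ u w, l = u ++ m :: w → cl m (w.headD 0) ∈ insert 0 (insert 1 K) := by
    rintro l hl u w rfl
    have hn := (mem_arr.1 hl).1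
    cases w with
    | nil => simp [cl]
    | cons a w =>
      have ha := ((mem_arr.1 hl).2.1 a).1 (by simp)
      rw [List.headD_cons]; unfold cl
      split_ifs with h h'
      · simp
      · simp
      · have : a ∈ K := by
          by_contra hk
          apply h'
          apply C.hV a ha _ hk
          rintro rfl
          simp [List.nodup_append] at hn
        simp [this]
  have hR1 : ∀ l ∈ arr V (S ∪ K), cl m (rn m l) ∈ insert 0 (insert 1 K) := by
    intro l hl
    obtain ⟨u, w, rfl⟩ := List.append_of_mem (((mem_arr.1 hl).2.1 m).2 C.hm)
    rw [rn_split _ _ (mem_arr.1 hl).1]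
    exact hR _ hl u w rfl
  have hR2 : ∀ l ∈ arr V (S ∪ K), cl m (rn m l.reverse) ∈ insert 0 (insert 1 K) := by
    intro l hl
    apply hR1
    rw [mem_arr] at hl ⊢
    simpa [pk_reverse] using hl
  have hsum : (arr V (S ∪ K)).card = ∑ p ∈ (insert 0 (insert 1 K)) ×ˢ (insert 0 (insert 1 K)),
      (fib m V (S ∪ K) p.1 p.2).card := by
    rw [Finset.card_eq_sum_card_fiberwise (f := fun l => (cl m (rn m l.reverse), cl m (rn m l)))
      (t := (insert 0 (insert 1 K)) ×ˢ (insert 0 (insert 1 K)))]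
    · apply Finset.sum_congr rfl
      rintro ⟨a, b⟩ _
      simp only [fib, Prod.mk.injEq]
    · intro l hl
      simp only [Finset.coe_product, Set.mem_prod]
      exact ⟨hR2 l hl, hR1 l hl⟩
  rw [hsum, Finset.sum_product]
  simp only [Finset.sum_insert z0, Finset.sum_insert z1, Finset.sum_add_distrib]
  have e1 : ∑ x ∈ K, (fib m V (S ∪ K) 0 x).card = K.card * N2 := by
    rw [Finset.sum_const_nat]; intro x hx; rw [C.c0x hx, h2 x hx]
  have e2 : ∑ x ∈ K, (fib m V (S ∪ K) x 0).card = K.card * N2 := by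
    rw [← e1]; exact Finset.sum_congr rfl fun x _ => fib_symm _ _ _ _ _
  have e3 : ∑ x ∈ K, (fib m V (S ∪ K) 1 x).card = K.card * N1 := by
    rw [Finset.sum_const_nat]; intro x hx; rw [C.c1x hx, h1]
  have e4 : ∑ x ∈ K, (fib m V (S ∪ K) x 1).card = K.card * N1 := by
    rw [← e3]; exact Finset.sum_congr rfl fun x _ => fib_symm _ _ _ _ _
  have e5 : ∑ x ∈ K, ∑ y ∈ K, (fib m V (S ∪ K) x y).card = K.card * ((K.card - 1) * N2) := by
    rw [Finset.sum_const_nat]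
    intro x hx
    rw [← Finset.add_sum_erase _ _ hx, C.cxx hx, zero_add, Finset.sum_const_nat (m := N2),
      Finset.card_erase_of_mem hx]
    intro y hy
    rw [Finset.mem_erase] at hy
    rw [C.cxy hx hy.2 hy.1.symm, h2 x hx]
  rw [e1, e2, e3, e4, e5, C.c00, C.c11, fib_symm _ _ _ 1 0, C.c01, h1]
  cases K.card with
  | zero => simp; ring
  | succ k => simp only [Nat.add_sub_cancel]; ring
end

theorem cp_union_top_interval_recurrence (k n : ℕ) (hn : k + 4 ≤ n) (S : Finset ℕ)
    (hS : S ⊆ Finset.Icc 3 (n - k - 1)) (hne : (CPperms n S).Nonempty) :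
    cp n (S ∪ Finset.Icc (n - k + 1) n) =
      2 * (k + 1) * cp (n - 1) (S ∪ Finset.Icc (n - k) (n - 1)) +
      k * (k + 1) * cp (n - 2) (S ∪ Finset.Icc (n - k) (n - 2)) := by
  obtain ⟨m, rfl⟩ : ∃ m, n = m + k := ⟨n - k, by omega⟩
  simp only [Nat.add_sub_cancel] at *
  have hS' : ∀ s ∈ S, 3 ≤ s ∧ s < m := fun s hs => by
    have := Finset.mem_Icc.1 (hS hs); omega
  have C : Ctx m (Finset.Icc 1 (m + k)) S (Finset.Icc (m + 1) (m + k)) := by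
    refine ⟨?_, by omega, ?_, ?_, ?_, by simp, fun s hs => (hS' s hs).2, 1, ?_, by omega⟩
    · simp; omega
    · intro x hx; simp at hx; omega
    · intro x hx; simp at hx ⊢; omega
    · intro x hx; simp at hx ⊢; omega
    · simp; omega
  rw [cp_eq, cp_eq, cp_eq]
  have hc : (Finset.Icc (m + 1) (m + k)).card = k := by simp
  have := C.main (arr (Finset.Icc 1 (m + k - 1)) (S ∪ Finset.Icc m (m + k - 1))).card
    (arr (Finset.Icc 1 (m + k - 2)) (S ∪ Finset.Icc m (m + k - 2))).card ?_ ?_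
  · rw [hc] at this; exact this
  · have hf : StrictMono (fun z => if z < m then z else z + 1) := by
      intro a b h; dsimp only; split_ifs <;> omega
    rw [← arr_map hf (Finset.Icc 1 (m + k - 1))]
    congr 2
    · ext z
      simp only [Finset.mem_erase, Finset.mem_Icc, Finset.mem_image]
      constructor
      · rintro ⟨h1, h2⟩
        refine ⟨if z < m then z else z - 1, ?_, ?_⟩ <;> split_ifs <;> omega
      · rintro ⟨a, h, rfl⟩
        split_ifs <;> omega
    · ext z
      simp only [Finset.mem_union, Finset.mem_Icc, Finset.mem_image]
      constructor
      · rintro (h | h)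
        · exact ⟨z, Or.inl h, if_pos (hS' z h).2⟩
        · exact ⟨z - 1, Or.inr (by omega), by rw [if_neg (by omega)]; omega⟩
      · rintro ⟨a, h | h, rfl⟩
        · rw [if_pos (hS' a h).2]; exact Or.inl h
        · rw [if_neg (by omega)]; right; omega
  · intro x hx
    rw [Finset.mem_Icc] at hx
    have hf : StrictMono (fun z => if z < m then z else if z + 1 < x then z + 1 else z + 2) := by
      intro a b h; dsimp only; split_ifs <;> omega
    rw [← arr_map hf (Finset.Icc 1 (m + k - 2))]
    congr 2
    · ext z
      simp only [Finset.mem_erase, Finset.mem_Icc, Finset.mem_image]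
      constructor
      · rintro ⟨h1, h2⟩
        refine ⟨if z < m then z else if z < x then z - 1 else z - 2, ?_, ?_⟩ <;>
          split_ifs <;> omega
      · rintro ⟨a, h, rfl⟩
        split_ifs <;> omega
    · ext z
      simp only [Finset.mem_union, Finset.mem_Icc, Finset.mem_image, Finset.mem_erase]
      constructor
      · rintro ⟨hz, h | h⟩
        · exact ⟨z, Or.inl h, if_pos (hS' z h).2⟩
        · refine ⟨if z < x then z - 1 else z - 2, Or.inr ?_, ?_⟩ <;> split_ifs <;> omega
      · rintro ⟨a, h | h, rfl⟩
        · have := hS' a h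
          rw [if_pos (hS' a h).2]; exact ⟨by omega, Or.inl h⟩
        · refine ⟨?_, Or.inr ?_⟩ <;> split_ifs <;> omega
end

section
/- Define rational numbers b_{k,i} for k ≥ 1 and 1 ≤ i ≤ k by b_{1,1} = 1/2 and, for k ≥ 1: b_{k+1,1} = k(k+1)²·Σ_{j=1}^{k} (−1)^{j+1} b_{k,j}, and b_{k+1,i} = k(k+1)·((k+2−i)/i)·b_{k,i−1} for 2 ≤ i ≤ k+1. Then for every k ≥ 1 and every n ≥ max{3, 2k} with CP_n([n−k+1, n]) ≠ ∅, cp_n([n−k+1, n]) = k(k+1)·Σ_{i=1}^{k} (−1)^{i+1} b_{k,i}·[(2k+2)^{n−2k} − (2k+2−2i)^{n−2k}]. -/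
theorem EE_cc : PowerSeries.constantCoeff (PowerSeries.rescale (2:ℚ) (PowerSeries.exp ℚ)) = 1 := by
  rw [← PowerSeries.coeff_zero_eq_constantCoeff_apply, PowerSeries.coeff_rescale, PowerSeries.coeff_exp]; simp

noncomputable def EE : PowerSeries ℚ :=
  PowerSeries.C (1/2 : ℚ) * (PowerSeries.rescale (2:ℚ) (PowerSeries.exp ℚ) - 1)

noncomputable def gg (m k : ℕ) : ℚ :=
  (m.factorial : ℚ) * k.factorial * PowerSeries.coeff m (EE ^ (k+1))

theorem gg_zero_zero : gg 0 0 = 0 := by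
  simp [gg, EE, EE_cc]

theorem gg_succ_zero (m : ℕ) : gg (m+1) 0 = 2 ^ m := by
  have : ((m+1).factorial : ℚ) ≠ 0 := by exact_mod_cast Nat.factorial_ne_zero _
  simp [gg, EE, PowerSeries.coeff_one, PowerSeries.coeff_rescale, PowerSeries.coeff_exp, pow_succ]
  field_simp

theorem gg_conv (m k : ℕ) :
    ∑ a ∈ Finset.range (m+1), ∑ c ∈ Finset.range (k+1),
      (m.choose a : ℚ) * (k.choose c : ℚ) * (gg a c * gg (m-a) (k-c)) = gg m (k+1) := by
  rw [Finset.sum_comm]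
  have h : ∀ c ∈ Finset.range (k+1), ∑ a ∈ Finset.range (m+1),
      (m.choose a : ℚ) * (k.choose c : ℚ) * (gg a c * gg (m-a) (k-c))
      = m.factorial * k.factorial * PowerSeries.coeff m (EE ^ (k+2)) := by
    intro c hc
    have hc' : c ≤ k := by simpa [Nat.lt_succ_iff] using hc
    have : EE ^ (k+2) = EE ^ (c+1) * EE ^ (k-c+1) := by
      rw [← pow_add]; congr 1; omega
    rw [this, PowerSeries.coeff_mul, Finset.Nat.sum_antidiagonal_eq_sum_range_succ_mk, Finset.mul_sum]
    refine Finset.sum_congr rfl fun a ha => ?_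
    have ha' : a ≤ m := by simpa [Nat.lt_succ_iff] using ha
    have e1 : (m.factorial : ℚ) = m.choose a * a.factorial * (m-a).factorial := by
      exact_mod_cast (Nat.choose_mul_factorial_mul_factorial ha').symm
    have e2 : (k.factorial : ℚ) = k.choose c * c.factorial * (k-c).factorial := by
      exact_mod_cast (Nat.choose_mul_factorial_mul_factorial hc').symm
    rw [e1, e2]; unfold gg; ring
  rw [Finset.sum_congr rfl h]
  simp [gg, Nat.factorial_succ]; ring

theorem gg_closed (m k : ℕ) : gg m k = k.factorial / 2^(k+1) *
    ∑ j ∈ Finset.range (k+2), (-1)^j * ((k+1).choose j : ℚ) * (2*((k:ℚ)+1-j))^m := by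
  have hm : (m.factorial : ℚ) ≠ 0 := by exact_mod_cast Nat.factorial_ne_zero _
  have key : PowerSeries.coeff m ((PowerSeries.rescale (2:ℚ) (PowerSeries.exp ℚ) - 1)^(k+1)) =
    ∑ j ∈ Finset.range (k+2), (-1)^j * ((k+1).choose j : ℚ) * (2*((k:ℚ)+1-j))^m / m.factorial := by
    rw [sub_eq_neg_add, add_pow, map_sum]
    refine Finset.sum_congr rfl fun j hj => ?_
    have hj' : j ≤ k+1 := by simpa [Nat.lt_succ_iff] using hj
    rw [← map_pow, PowerSeries.exp_pow_eq_rescale_exp, PowerSeries.rescale_rescale]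
    have e : ((-1 : PowerSeries ℚ))^j = PowerSeries.C ((-1:ℚ)^j) := by simp
    have e2 : (((k+1).choose j : ℕ) : PowerSeries ℚ) = PowerSeries.C (((k+1).choose j : ℕ) : ℚ) := by simp
    rw [e, e2, mul_assoc, PowerSeries.coeff_C_mul, PowerSeries.coeff_mul_C, PowerSeries.coeff_rescale, PowerSeries.coeff_exp]
    push_cast [Nat.cast_sub hj']
    simp
    ring
  rw [gg, EE, mul_pow, ← map_pow, PowerSeries.coeff_C_mul, key, Finset.mul_sum, Finset.mul_sum, Finset.mul_sum]
  refine Finset.sum_congr rfl fun j hj => ?_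
  have h2 : (1/2:ℚ)^(k+1) * 2^(k+1) = 1 := by rw [← mul_pow]; norm_num
  field_simp
  linear_combination ((k + 1).choose j : ℚ) * (2 * (k + 1 - j)) ^ m * h2

theorem gg_diag (k : ℕ) : gg k k = 0 := by
  have h : PowerSeries.X ∣ EE := by
    rw [PowerSeries.X_dvd_iff]; simp [EE, EE_cc]
  have := (PowerSeries.X_pow_dvd_iff.1 (pow_dvd_pow_of_dvd h (k+1))) k (by omega)
  simp [gg, this]

theorem alt_sum (k : ℕ) (hk : 1 ≤ k) :
    ∑ j ∈ Finset.Icc 1 k, (-1)^(j+1) * ((k+1).choose j : ℚ) * ((k:ℚ)+1-j)^k = ((k:ℚ)+1)^k := by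
  have h := gg_diag k
  rw [gg_closed] at h
  have hf : ((k.factorial : ℚ) / 2^(k+1)) ≠ 0 := by
    have : (k.factorial : ℚ) ≠ 0 := by exact_mod_cast Nat.factorial_ne_zero _
    positivity
  have h := (mul_eq_zero.1 h).resolve_left hf
  rw [Finset.sum_range_succ, Finset.sum_range_succ'] at h
  have e : ∑ j ∈ Finset.Icc 1 k, (-1)^(j+1) * ((k+1).choose j : ℚ) * ((k:ℚ)+1-j)^k
    = ∑ j ∈ Finset.range k, (-1)^(j+2) * ((k+1).choose (j+1) : ℚ) * ((k:ℚ)+1-(j+1:ℕ))^k := by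
    have := Finset.sum_Ico_add' (fun j : ℕ => (-1)^(j+1) * ((k+1).choose j : ℚ) * ((k:ℚ)+1-j)^k) 0 k 1
    rw [Finset.range_eq_Ico]; exact this.symm
  rw [e]
  simp only [mul_pow] at h
  have h2 : (2:ℚ)^k ≠ 0 := by positivity
  have hk0 : k ≠ 0 := by omega
  have e3 : ∑ j ∈ Finset.range k, (-1)^(j+1) * ((k+1).choose (j+1) : ℚ) * (2^k * ((k:ℚ)+1-(j+1:ℕ))^k)
    = - (2^k * ∑ j ∈ Finset.range k, (-1)^(j+2) * ((k+1).choose (j+1) : ℚ) * ((k:ℚ)+1-(j+1:ℕ))^k) := by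
    rw [Finset.mul_sum, ← Finset.sum_neg_distrib]
    refine Finset.sum_congr rfl fun j hj => ?_
    ring
  rw [e3] at h
  apply mul_left_cancel₀ h2
  have e4 : ((k:ℚ)+1-((k+1:ℕ):ℚ))^k = 0 := by
    push_cast; rw [sub_self, zero_pow hk0]
  rw [e4] at h
  simp only [pow_zero, Nat.choose_zero_right, Nat.cast_zero, Nat.cast_one, sub_zero, mul_zero, add_zero, one_mul] at h
  linarith

theorem b_closed (b : ℕ → ℕ → ℚ) (hb1 : b 1 1 = 1 / 2)
    (hbrec1 : ∀ k, 1 ≤ k →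
      b (k + 1) 1 = (k : ℚ) * ((k : ℚ) + 1) ^ 2 *
        ∑ j ∈ Finset.Icc 1 k, (-1) ^ (j + 1) * b k j)
    (hbrec2 : ∀ k, 1 ≤ k → ∀ i, 2 ≤ i → i ≤ k + 1 →
      b (k + 1) i = (k : ℚ) * ((k : ℚ) + 1) * (((k : ℚ) + 2 - (i : ℚ)) / (i : ℚ)) *
        b k (i - 1)) (k : ℕ) (hk : 1 ≤ k) : ∀ i, 1 ≤ i → i ≤ k →
    b k i = k.factorial * (k+1).choose i * ((k:ℚ)+1-i)^k / (2 * k * (k+1)) := by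
  induction k, hk using Nat.le_induction with
  | base => intro i h1 h2
            obtain rfl : i = 1 := by omega
            rw [hb1]; norm_num
  | succ k hk ih =>
    intro i h1 h2
    have hk' : (k:ℚ) ≠ 0 := by exact_mod_cast (by omega : k ≠ 0)
    have hk1 : (k:ℚ)+1 ≠ 0 := by positivity
    have hk2 : (k:ℚ)+2 ≠ 0 := by positivity
    rcases Nat.lt_or_ge i 2 with h | h
    · obtain rfl : i = 1 := by omega
      rw [hbrec1 k hk]
      have : ∑ j ∈ Finset.Icc 1 k, (-1) ^ (j + 1) * b k j = k.factorial / (2*k*(k+1)) * ((k:ℚ)+1)^k := by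
        rw [← alt_sum k hk, Finset.mul_sum]
        refine Finset.sum_congr rfl fun j hj => ?_
        rw [Finset.mem_Icc] at hj
        rw [ih j hj.1 hj.2]; ring
      rw [this, Nat.choose_one_right, Nat.factorial_succ]
      push_cast
      have : (k:ℚ)+1+1 ≠ 0 := by positivity
      field_simp
      ring
    · rw [hbrec2 k hk i h h2]
      obtain ⟨i, rfl⟩ : ∃ i', i = i'+1 := ⟨i-1, by omega⟩
      rw [Nat.add_sub_cancel, ih i (by omega) (by omega), Nat.factorial_succ]
      have hc : (((k+1+1).choose (i+1) : ℕ) : ℚ) * (i+1) = (k+2) * (k+1).choose i := by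
        have := Nat.add_one_mul_choose_eq (k+1) i
        have h3 : (((k+1+1) * (k+1).choose i : ℕ):ℚ) = (((k+1+1).choose (i+1) * (i+1) : ℕ) : ℚ) := by
          exact_mod_cast this
        push_cast at h3; linarith
      have hi : (i:ℚ)+1 ≠ 0 := by positivity
      have hc : (((k+1+1).choose (i+1) : ℕ) : ℚ) = (k+2) * (k+1).choose i / (i+1) := by
        rw [← hc]; field_simp
      rw [hc]
      push_cast
      have e : (k:ℚ)+1+1 = k+2 := by ring
      have e2 : (k:ℚ)+2 - (i+1) = k+1-i := by ring
      rw [e, e2, pow_succ]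
      field_simp

theorem final_alg (b : ℕ → ℕ → ℚ) (k : ℕ) (hk : 1 ≤ k) (hb : ∀ i, 1 ≤ i → i ≤ k →
    b k i = k.factorial * (k+1).choose i * ((k:ℚ)+1-i)^k / (2 * k * (k+1))) (d : ℕ) :
    gg (k+d) k = (k : ℚ) * ((k : ℚ) + 1) * ∑ i ∈ Finset.Icc 1 k, (-1) ^ (i + 1) * b k i *
          ((2 * (k : ℚ) + 2) ^ d - (2 * (k : ℚ) + 2 - 2 * (i : ℚ)) ^ d) := by
  have hk' : (k:ℚ) ≠ 0 := by exact_mod_cast (by omega : k ≠ 0)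
  have hk1 : (k:ℚ)+1 ≠ 0 := by positivity
  have e1 : ∑ i ∈ Finset.Icc 1 k, (-1) ^ (i + 1) * b k i *
          ((2 * (k : ℚ) + 2) ^ d - (2 * (k : ℚ) + 2 - 2 * (i : ℚ)) ^ d)
      = k.factorial / (2 * k * (k+1)) * ((2*k+2)^d * ((k:ℚ)+1)^k + ∑ i ∈ Finset.Icc 1 k,
       (-1)^i * ((k+1).choose i : ℚ) * ((k:ℚ)+1-i)^k * (2*((k:ℚ)+1-i))^d) := by
    rw [← alt_sum k hk, Finset.mul_sum, ← Finset.sum_add_distrib, Finset.mul_sum]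
    refine Finset.sum_congr rfl fun j hj => ?_
    rw [Finset.mem_Icc] at hj
    rw [hb j hj.1 hj.2, pow_succ, show (2 * (k : ℚ) + 2 - 2 * (j : ℚ)) = 2*((k:ℚ)+1-j) by ring]; ring
  rw [e1, gg_closed, Finset.sum_range_succ, Finset.sum_range_succ']
  have e : ∑ i ∈ Finset.Icc 1 k, (-1)^i * ((k+1).choose i : ℚ) * ((k:ℚ)+1-i)^k * (2*((k:ℚ)+1-i))^d
    = ∑ j ∈ Finset.range k, (-1)^(j+1) * ((k+1).choose (j+1) : ℚ) * ((k:ℚ)+1-(j+1:ℕ))^k * (2*((k:ℚ)+1-(j+1:ℕ)))^d := by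
    rw [Finset.range_eq_Ico, Finset.sum_Ico_add' (fun i => (-1)^i * ((k+1).choose i : ℚ) * ((k:ℚ)+1-i)^k * (2*((k:ℚ)+1-i))^d) 0 k 1]
    rfl
  have e3 : ∑ j ∈ Finset.range k, (-1)^(j+1) * ((k+1).choose (j+1) : ℚ) * (2*((k:ℚ)+1-(j+1:ℕ)))^(k+d)
    = 2^k * ∑ j ∈ Finset.range k, (-1)^(j+1) * ((k+1).choose (j+1) : ℚ) * ((k:ℚ)+1-(j+1:ℕ))^k * (2*((k:ℚ)+1-(j+1:ℕ)))^d := by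
    rw [Finset.mul_sum]
    refine Finset.sum_congr rfl fun j hj => ?_
    rw [pow_add (2*((k:ℚ)+1-(j+1:ℕ))) k d, mul_pow 2 _ k]; ring
  have e4 : (2*((k:ℚ)+1-((k+1:ℕ):ℚ)))^(k+d) = 0 := by
    push_cast; rw [sub_self, mul_zero, zero_pow (by omega)]
  rw [e, e3, e4]
  generalize ∑ j ∈ Finset.range k, (-1)^(j+1) * ((k+1).choose (j+1) : ℚ) * ((k:ℚ)+1-(j+1:ℕ))^k * (2*((k:ℚ)+1-(j+1:ℕ)))^d = S
  have e5 : (2*((k:ℚ)+1-((0:ℕ):ℚ)))^(k+d) = 2^k * (k+1)^k * (2*k+2)^d := by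
    rw [pow_add, mul_pow]; push_cast; ring
  rw [e5]
  simp
  rw [pow_succ]
  field_simp
  ring


def G0 (t : ℕ) (l : List ℕ) : Prop := ∀ j < l.length,
  (t ≤ l.getD j 0 ↔ 0 < j ∧ j + 1 < l.length ∧ l.getD (j-1) 0 < l.getD j 0 ∧ l.getD (j+1) 0 < l.getD j 0)

theorem G0_split (t M : ℕ) (A B : List ℕ) (hA : ∀ x ∈ A, x < M) (hB : ∀ x ∈ B, x < M) :
    G0 t (A ++ M :: B) ↔ G0 t A ∧ G0 t B ∧ (t ≤ M ↔ A ≠ [] ∧ B ≠ []) := by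
  have gA : ∀ j, j < A.length → (A ++ M :: B).getD j 0 = A.getD j 0 := by
    intro j hj; rw [List.getD_append _ _ _ _ hj]
  have gM : (A ++ M :: B).getD A.length 0 = M := by simp
  have gB : ∀ j, (A ++ M :: B).getD (A.length + 1 + j) 0 = B.getD j 0 := by
    intro j
    rw [List.getD_append_right _ _ _ _ (by omega)]
    rw [show A.length + 1 + j - A.length = j + 1 by omega]; simp
  have lA : ∀ j, j < A.length → A.getD j 0 < M := by
    intro j hj; rw [List.getD_eq_getElem _ _ hj]; exact hA _ (List.getElem_mem _)
  have lB : ∀ j, j < B.length → B.getD j 0 < M := by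
    intro j hj; rw [List.getD_eq_getElem _ _ hj]; exact hB _ (List.getElem_mem _)
  have hlen : (A ++ M :: B).length = A.length + 1 + B.length := by simp; omega
  rw [← List.length_pos_iff, ← List.length_pos_iff]
  have pA : ∀ j, j < A.length → 
    ((t ≤ (A ++ M :: B).getD j 0 ↔ 0 < j ∧ j + 1 < (A ++ M :: B).length ∧ (A ++ M :: B).getD (j-1) 0 < (A ++ M :: B).getD j 0 ∧ (A ++ M :: B).getD (j+1) 0 < (A ++ M :: B).getD j 0) ↔ (t ≤ A.getD j 0 ↔ 0 < j ∧ j + 1 < A.length ∧ A.getD (j-1) 0 < A.getD j 0 ∧ A.getD (j+1) 0 < A.getD j 0)) := by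
    intro j hj
    rw [gA j hj, gA (j-1) (by omega), hlen]
    rcases Nat.lt_or_ge (j+1) A.length with h | h
    · rw [gA (j+1) h]
      have : j + 1 < A.length + 1 + B.length := by omega
      simp [h, this]
    · have : j + 1 = A.length := by omega
      rw [this, gM]
      have := lA j hj
      have h3 : ¬ (M < A.getD j 0) := by omega
      simp only [h3, lt_irrefl, and_false, false_and]
  have pB : ∀ j, j < B.length → 
    ((t ≤ (A ++ M :: B).getD (A.length+1+j) 0 ↔ 0 < A.length+1+j ∧ A.length+1+j + 1 < (A ++ M :: B).length ∧ (A ++ M :: B).getD (A.length+1+j-1) 0 < (A ++ M :: B).getD (A.length+1+j) 0 ∧ (A ++ M :: B).getD (A.length+1+j+1) 0 < (A ++ M :: B).getD (A.length+1+j) 0) ↔ (t ≤ B.getD j 0 ↔ 0 < j ∧ j + 1 < B.length ∧ B.getD (j-1) 0 < B.getD j 0 ∧ B.getD (j+1) 0 < B.getD j 0)) := by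
    intro j hj
    rw [gB j, show A.length + 1 + j + 1 = A.length + 1 + (j+1) by omega, gB (j+1), hlen]
    rcases Nat.eq_zero_or_pos j with h | h
    · subst h
      rw [show A.length + 1 + 0 - 1 = A.length by omega, gM]
      have := lB 0 hj
      have h3 : ¬ (M < B.getD 0 0) := by omega
      simp only [h3, lt_irrefl, and_false, false_and]
    · rw [show A.length + 1 + j - 1 = A.length + 1 + (j-1) by omega, gB]
      have h1 : 0 < A.length + 1 + j := by omega
      have h2 : (A.length + 1 + (j+1) < A.length + 1 + B.length) ↔ j + 1 < B.length := by omega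
      simp only [h1, h2, h, true_and]
  have pM : (t ≤ (A ++ M :: B).getD (A.length) 0 ↔ 0 < A.length ∧ A.length + 1 < (A ++ M :: B).length ∧ (A ++ M :: B).getD (A.length-1) 0 < (A ++ M :: B).getD (A.length) 0 ∧ (A ++ M :: B).getD (A.length+1) 0 < (A ++ M :: B).getD (A.length) 0) ↔ (t ≤ M ↔ 0 < A.length ∧ 0 < B.length) := by
    rw [gM, hlen, show A.length + 1 = A.length + 1 + 0 by omega, gB]
    have h2 : (A.length + 1 + 0 < A.length + 1 + 0 + B.length) ↔ 0 < B.length := by omega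
    rw [h2]
    apply iff_congr Iff.rfl
    constructor
    · tauto
    · rintro ⟨ha, hb⟩
      refine ⟨ha, hb, ?_, lB 0 hb⟩
      rw [gA _ (by omega)]; exact lA _ (by omega)
  constructor
  · intro h
    refine ⟨fun j hj => (pA j hj).1 (h j (by omega)), fun j hj => (pB j hj).1 (h _ (by omega)), pM.1 (h _ (by omega))⟩
  · rintro ⟨h1, h2, h3⟩ j hj
    rcases lt_trichotomy j A.length with h | h | h
    · exact (pA j h).2 (h1 j h)
    · subst h; exact pM.2 h3
    · obtain ⟨i, rfl⟩ : ∃ i, j = A.length + 1 + i := ⟨j - (A.length+1), by omega⟩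
      have hi : i < B.length := by omega
      exact (pB i hi).2 (h2 i hi)

open Classical in
/-- Good lists on the letters of `V`. -/
noncomputable def LL (t : ℕ) (V : Finset ℕ) : Finset (List ℕ) :=
  V.val.lists.toFinset.filter (fun l => l ≠ [] ∧ G0 t l)

theorem mem_LL (t : ℕ) (V : Finset ℕ) (l : List ℕ) :
    l ∈ LL t V ↔ (l.Nodup ∧ l.toFinset = V) ∧ l ≠ [] ∧ G0 t l := by
  classical
  rw [LL, Finset.mem_filter, Multiset.mem_toFinset, Multiset.mem_lists_iff]
  refine and_congr_left fun _ => ?_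
  constructor
  · intro h
    have hn : l.Nodup := by
      have := V.nodup; rw [h] at this; simpa using this
    refine ⟨hn, ?_⟩
    apply Finset.val_injective
    rw [h, List.toFinset_val, hn.dedup]; rfl
  · rintro ⟨hn, rfl⟩
    rw [List.toFinset_val, hn.dedup]; rfl

theorem LL_empty (t : ℕ) : LL t ∅ = ∅ := by
  ext l; rw [mem_LL]; simp; tauto

theorem split_iff (W : Finset ℕ) (M : ℕ) (hM : ∀ x ∈ W, x < M) (A B : List ℕ) :
    ((A ++ M :: B).Nodup ∧ (A ++ M :: B).toFinset = insert M W) ↔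
     A.Nodup ∧ A.toFinset ⊆ W ∧ B.Nodup ∧ B.toFinset = W \ A.toFinset := by
  have hMW : M ∉ W := fun h => lt_irrefl _ (hM M h)
  constructor
  · rintro ⟨h1, h2⟩
    simp only [List.nodup_append, List.nodup_cons, List.mem_cons] at h1
    obtain ⟨a, ⟨b, c⟩, d⟩ := h1
    simp only [Finset.ext_iff, List.mem_toFinset, List.mem_append, List.mem_cons, Finset.mem_insert] at h2
    refine ⟨a, ?_, c, ?_⟩
    · intro x hx
      have hx := List.mem_toFinset.1 hx
      have := (h2 x).1 (Or.inl hx)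
      have := d x hx M (Or.inl rfl)
      tauto
    · ext x
      simp only [List.mem_toFinset, Finset.mem_sdiff]
      have e1 := h2 x
      constructor
      · intro hx
        have : x ≠ M := by rintro rfl; exact b hx
        refine ⟨by tauto, fun h => d x h x (Or.inr hx) rfl⟩
      · rintro ⟨hx, hx2⟩
        have : x ≠ M := by rintro rfl; exact hMW hx
        tauto
  · rintro ⟨a, s, c, e⟩
    simp only [Finset.ext_iff, List.mem_toFinset, Finset.mem_sdiff] at e
    have s' : ∀ x ∈ A, x ∈ W := fun x hx => s (List.mem_toFinset.2 hx)
    constructor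
    · simp only [List.nodup_append, List.nodup_cons, List.mem_cons]
      refine ⟨a, ⟨fun h => hMW ((e M).1 h).1, c⟩, ?_⟩
      rintro x hx y (rfl | hy) rfl
      · exact hMW (s' _ hx)
      · exact ((e _).1 hy).2 hx
    · ext x
      simp only [List.mem_toFinset, List.mem_append, List.mem_cons, Finset.mem_insert]
      have := e x; have := s' x
      tauto

theorem append_inj_mid (M : ℕ) (A B A' B' : List ℕ) (h : M ∉ A) (h' : M ∉ A')
    (e : A ++ M :: B = A' ++ M :: B') : A = A' ∧ B = B' := by
  induction A generalizing A' with
  | nil => cases A' with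
    | nil => simpa using e
    | cons a A' => simp at e h'; tauto
  | cons a A ih => cases A' with
    | nil => simp at e h; tauto
    | cons a' A' =>
      simp at e h h'
      have := ih A' h.2 h'.2 e.2
      simp [e.1, this]

theorem card_top (t M : ℕ) (W : Finset ℕ) (hM : ∀ x ∈ W, x < M) (ht : t ≤ M) :
    (LL t (insert M W)).card = ∑ U ∈ W.powerset, (LL t U).card * (LL t (W \ U)).card := by
  have hMW : M ∉ W := fun h => lt_irrefl _ (hM M h)
  rw [← Finset.sum_congr rfl (fun U _ => Finset.card_product (LL t U) (LL t (W \ U))), ← Finset.card_sigma]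
  symm
  apply Finset.card_bij (fun (p : Σ _ : Finset ℕ, List ℕ × List ℕ) _ => p.2.1 ++ M :: p.2.2)
  · rintro ⟨U, A, B⟩ h
    simp only [Finset.mem_sigma, Finset.mem_powerset, Finset.mem_product, mem_LL] at h
    obtain ⟨hU, ⟨⟨a1, rfl⟩, a3, a4⟩, ⟨b1, b2⟩, b3, b4⟩ := h
    rw [mem_LL]
    refine ⟨(split_iff W M hM A B).2 ⟨a1, hU, b1, b2⟩, by simp, ?_⟩
    rw [G0_split]
    · exact ⟨a4, b4, by simp [ht, a3, b3]⟩
    · exact fun x hx => hM x (hU (List.mem_toFinset.2 hx))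
    · intro x hx
      have := List.mem_toFinset.2 hx
      rw [b2] at this
      exact hM x (Finset.mem_sdiff.1 this).1
  · rintro ⟨U, A, B⟩ h ⟨U', A', B'⟩ h' e
    simp only [Finset.mem_sigma, Finset.mem_powerset, Finset.mem_product, mem_LL] at h h' e
    obtain ⟨hU, ⟨⟨a1, rfl⟩, a3, a4⟩, ⟨b1, b2⟩, b3, b4⟩ := h
    obtain ⟨hU', ⟨⟨a1', rfl⟩, a3', a4'⟩, ⟨b1', b2'⟩, b3', b4'⟩ := h'
    obtain ⟨rfl, rfl⟩ := append_inj_mid M A B A' B' (fun h => hMW (hU (List.mem_toFinset.2 h)))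
      (fun h => hMW (hU' (List.mem_toFinset.2 h))) e
    rfl
  · intro l hl
    rw [mem_LL] at hl
    obtain ⟨⟨h1, h2⟩, h3, h4⟩ := hl
    have : M ∈ l := by rw [← List.mem_toFinset, h2]; simp
    obtain ⟨A, B, rfl⟩ := List.append_of_mem this
    obtain ⟨a, b, c, d⟩ := (split_iff W M hM A B).1 ⟨h1, h2⟩
    rw [G0_split] at h4
    · obtain ⟨x, y, z⟩ := h4
      have z := z.1 ht
      refine ⟨⟨A.toFinset, A, B⟩, ?_, rfl⟩
      simp only [Finset.mem_sigma, Finset.mem_powerset, Finset.mem_product, mem_LL]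
      exact ⟨b, ⟨⟨a, trivial⟩, z.1, x⟩, ⟨c, d⟩, z.2, y⟩
    · exact fun x hx => hM x (b (List.mem_toFinset.2 hx))
    · intro x hx
      have := List.mem_toFinset.2 hx
      rw [d] at this
      exact hM x (Finset.mem_sdiff.1 this).1

theorem G0_nil (t : ℕ) : G0 t [] := by intro j hj; simp at hj

theorem card_low (t M : ℕ) (W : Finset ℕ) (hW : W.Nonempty) (hM : ∀ x ∈ W, x < M) (ht : M < t) :
    (LL t (insert M W)).card = 2 * (LL t W).card := by
  classical
  have hMW : M ∉ W := fun h => lt_irrefl _ (hM M h)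
  have e : LL t (insert M W) = (LL t W).image (fun l => M :: l) ∪ (LL t W).image (fun l => l ++ [M]) := by
    ext l
    simp only [Finset.mem_union, Finset.mem_image]
    constructor
    · intro hl
      rw [mem_LL] at hl
      obtain ⟨⟨h1, h2⟩, h3, h4⟩ := hl
      have : M ∈ l := by rw [← List.mem_toFinset, h2]; simp
      obtain ⟨A, B, rfl⟩ := List.append_of_mem this
      obtain ⟨a, b, c, d⟩ := (split_iff W M hM A B).1 ⟨h1, h2⟩
      rw [G0_split] at h4
      · obtain ⟨x, y, z⟩ := h4
        have z : ¬ (A ≠ [] ∧ B ≠ []) := fun h => by have := z.2 h; omega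
        by_cases hA : A = []
        · left
          subst hA
          simp at d
          refine ⟨B, ?_, rfl⟩
          rw [mem_LL]
          refine ⟨⟨c, d⟩, ?_, y⟩
          rintro rfl
          simp at d; subst d; simp at hW
        · right
          have hB : B = [] := by tauto
          subst hB
          refine ⟨A, ?_, rfl⟩
          rw [mem_LL]
          refine ⟨⟨a, ?_⟩, hA, x⟩
          apply Finset.Subset.antisymm b
          rw [← Finset.sdiff_eq_empty_iff_subset, ← d]; rfl
      · exact fun x hx => hM x (b (List.mem_toFinset.2 hx))
      · intro x hx
        have := List.mem_toFinset.2 hx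
        rw [d] at this
        exact hM x (Finset.mem_sdiff.1 this).1
    · rintro (⟨B, hB, rfl⟩ | ⟨A, hA, rfl⟩)
      · rw [mem_LL] at hB
        obtain ⟨⟨h1, rfl⟩, h3, h4⟩ := hB
        rw [mem_LL]
        refine ⟨(split_iff _ M hM [] B).2 (by simp [h1]), by simp, ?_⟩
        refine (G0_split t M [] B (by simp) (fun x hx => hM x (List.mem_toFinset.2 hx))).2 ⟨G0_nil t, h4, ?_⟩
        simp; omega
      · rw [mem_LL] at hA
        obtain ⟨⟨h1, rfl⟩, h3, h4⟩ := hA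
        rw [mem_LL]
        refine ⟨(split_iff _ M hM A []).2 (by simp [h1]), by simp, ?_⟩
        refine (G0_split t M A [] (fun x hx => hM x (List.mem_toFinset.2 hx)) (by simp)).2 ⟨h4, G0_nil t, ?_⟩
        simp; omega
  rw [e, Finset.card_union_of_disjoint, Finset.card_image_of_injective, Finset.card_image_of_injective]
  · ring
  · intro a b h; simpa using h
  · intro a b h; simpa using h
  · rw [Finset.disjoint_left]
    intro l h1 h2
    simp only [Finset.mem_image] at h1 h2
    obtain ⟨a, ha, rfl⟩ := h1
    obtain ⟨b, hb, e⟩ := h2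
    rw [mem_LL] at ha hb
    cases b with
    | nil => exact hb.2.1 rfl
    | cons x b =>
      simp at e
      apply hMW
      rw [← hb.1.2, e.1]; simp

theorem card_single (t M : ℕ) (ht : M < t) : (LL t {M}).card = 1 := by
  rw [Finset.card_eq_one]
  refine ⟨[M], ?_⟩
  ext l
  rw [mem_LL, Finset.mem_singleton]
  constructor
  · rintro ⟨⟨h1, h2⟩, h3, -⟩
    have : l.length = 1 := by rw [← List.toFinset_card_of_nodup h1, h2]; simp
    obtain ⟨a, rfl⟩ := List.length_eq_one_iff.1 this
    simpa using h2
  · rintro rfl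
    refine ⟨by simp, by simp, ?_⟩
    refine (G0_split t M [] [] (by simp) (by simp)).2 ⟨G0_nil t, G0_nil t, ?_⟩
    simp; omega

theorem sum_powerset_split (t : ℕ) (W : Finset ℕ) (f : ℕ → ℕ → ℚ) :
    ∑ U ∈ W.powerset, f (U.filter (· < t)).card (U.filter (t ≤ ·)).card =
    ∑ U1 ∈ (W.filter (· < t)).powerset, ∑ U2 ∈ (W.filter (t ≤ ·)).powerset, f U1.card U2.card := by
  rw [← Finset.sum_product']
  refine Finset.sum_bij' (fun U _ => (U.filter (· < t), U.filter (t ≤ ·))) (fun p _ => p.1 ∪ p.2) ?_ ?_ ?_ ?_ ?_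
  · intro U hU
    simp only [Finset.mem_powerset, Finset.mem_product] at *
    exact ⟨Finset.filter_subset_filter _ hU, Finset.filter_subset_filter _ hU⟩
  · rintro ⟨U1, U2⟩ h
    simp only [Finset.mem_powerset, Finset.mem_product] at *
    exact Finset.union_subset (h.1.trans (Finset.filter_subset _ _)) (h.2.trans (Finset.filter_subset _ _))
  · intro U hU
    ext x; simp only [Finset.mem_union, Finset.mem_filter]
    have := lt_or_ge x t
    tauto
  · rintro ⟨U1, U2⟩ h
    simp only [Finset.mem_powerset, Finset.mem_product] at *
    have h1 : ∀ x ∈ U1, x < t := fun x hx => (Finset.mem_filter.1 (h.1 hx)).2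
    have h2 : ∀ x ∈ U2, t ≤ x := fun x hx => (Finset.mem_filter.1 (h.2 hx)).2
    ext x
    · simp only [Finset.mem_union, Finset.mem_filter]
      have := h1 x; have := h2 x; have := @not_le _ _ x t
      grind
    · simp only [Finset.mem_union, Finset.mem_filter]
      have := h1 x; have := h2 x
      grind
  · intro U hU; rfl

theorem LL_card (t : ℕ) (V : Finset ℕ) :
    ((LL t V).card : ℚ) = gg (V.filter (· < t)).card (V.filter (t ≤ ·)).card := by
  induction V using Finset.strongInduction with
  | H V ih =>
  rcases V.eq_empty_or_nonempty with rfl | hV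
  · simp [LL_empty, gg_zero_zero]
  set M := V.max' hV with hMdef
  have hMV : M ∈ V := V.max'_mem hV
  obtain ⟨W, hW⟩ : ∃ W, W = V.erase M := ⟨_, rfl⟩
  have hVW : V = insert M W := by rw [hW, Finset.insert_erase hMV]
  have hM : ∀ x ∈ W, x < M := by
    intro x hx
    rw [hW, Finset.mem_erase] at hx
    exact lt_of_le_of_ne (V.le_max' x hx.2) hx.1
  have hMW : M ∉ W := fun h => lt_irrefl _ (hM M h)
  have hWV : W ⊂ V := by rw [hVW]; exact Finset.ssubset_insert hMW
  clear_value M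
  rcases Nat.lt_or_ge M t with ht | ht
  · have a1 : V.filter (· < t) = V := by
      rw [Finset.filter_eq_self]; intro x hx
      rw [hVW, Finset.mem_insert] at hx
      rcases hx with rfl | hx
      · exact ht
      · exact (hM x hx).trans ht
    have a2 : V.filter (t ≤ ·) = ∅ := by
      rw [Finset.filter_eq_empty_iff]; intro x hx
      rw [← a1] at hx
      exact not_le.2 (Finset.mem_filter.1 hx).2
    rcases W.eq_empty_or_nonempty with h0 | h0
    · rw [a1, a2, hVW, h0]
      have := gg_succ_zero 0
      simp at this
      simp [card_single t M ht, this]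
    · have i := ih W hWV
      have b1 : W.filter (· < t) = W := by
        rw [Finset.filter_eq_self]; intro x hx
        exact (hM x hx).trans ht
      have b2 : W.filter (t ≤ ·) = ∅ := by
        rw [Finset.filter_eq_empty_iff]; intro x hx
        exact not_le.2 ((hM x hx).trans ht)
      rw [b1, b2] at i
      rw [a1, a2, hVW, card_low t M W h0 hM ht, Finset.card_insert_of_notMem hMW]
      push_cast
      rw [i]
      obtain ⟨m, hm⟩ : ∃ m, W.card = m + 1 := ⟨W.card - 1, by have := h0.card_pos; omega⟩
      rw [hm, Finset.card_empty, gg_succ_zero, gg_succ_zero, pow_succ]; ring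
  · have a1 : V.filter (· < t) = W.filter (· < t) := by
      rw [hVW, Finset.filter_insert, if_neg (by omega)]
    have a2 : (V.filter (t ≤ ·)).card = (W.filter (t ≤ ·)).card + 1 := by
      rw [hVW, Finset.filter_insert, if_pos ht, Finset.card_insert_of_notMem]
      intro h; exact hMW (Finset.mem_filter.1 h).1
    rw [a1, a2, ← gg_conv]
    conv_lhs => rw [hVW]
    rw [card_top t M W hM ht]
    push_cast
    have h : ∀ U ∈ W.powerset, ((LL t U).card : ℚ) * ((LL t (W \ U)).card : ℚ) =
      (fun a c => gg a c * gg ((W.filter (· < t)).card - a) ((W.filter (t ≤ ·)).card - c)) (U.filter (· < t)).card (U.filter (t ≤ ·)).card := by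
      intro U hU
      have hU := Finset.mem_powerset.1 hU
      rw [ih U (Finset.ssubset_of_subset_of_ssubset hU hWV), ih (W \ U) (Finset.ssubset_of_subset_of_ssubset Finset.sdiff_subset hWV)]
      have e : ∀ (p : ℕ → Prop) [DecidablePred p], ((W \ U).filter p).card = (W.filter p).card - (U.filter p).card := by
        intro p _
        rw [← Finset.card_sdiff_of_subset (Finset.filter_subset_filter p hU)]
        congr 1
        ext x; simp only [Finset.mem_sdiff, Finset.mem_filter]; tauto
      simp only [e]
    rw [Finset.sum_congr rfl h, sum_powerset_split t W (fun a c => gg a c * gg ((W.filter (· < t)).card - a) ((W.filter (t ≤ ·)).card - c))]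
    have h2 : ∀ U1 : Finset ℕ, ∑ U2 ∈ (W.filter (t ≤ ·)).powerset, (gg U1.card U2.card * gg ((W.filter (· < t)).card - U1.card) ((W.filter (t ≤ ·)).card - U2.card)) = (fun a => ∑ c ∈ Finset.range ((W.filter (t ≤ ·)).card + 1), ((W.filter (t ≤ ·)).card.choose c : ℚ) * (gg a c * gg ((W.filter (· < t)).card - a) ((W.filter (t ≤ ·)).card - c))) U1.card := by
      intro U1
      rw [Finset.sum_powerset_apply_card (fun c => gg U1.card c * gg ((W.filter (· < t)).card - U1.card) ((W.filter (t ≤ ·)).card - c))]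
      simp
    rw [Finset.sum_congr rfl (fun U1 _ => h2 U1), Finset.sum_powerset_apply_card (fun a => ∑ c ∈ Finset.range ((W.filter (t ≤ ·)).card + 1), ((W.filter (t ≤ ·)).card.choose c : ℚ) * (gg a c * gg ((W.filter (· < t)).card - a) ((W.filter (t ≤ ·)).card - c)))]
    refine Finset.sum_congr rfl fun a _ => ?_
    rw [nsmul_eq_mul, Finset.mul_sum]
    refine Finset.sum_congr rfl fun c _ => ?_
    ring

theorem cps_iff (n t : ℕ) (ht : 1 ≤ t) (σ : Equiv.Perm (Fin n)) :
    circularPeakSet n σ = Finset.Icc t n ↔ ∀ j < n, (t ≤ permToFun n σ j ↔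
      0 < j ∧ j + 1 < n ∧ permToFun n σ (j-1) < permToFun n σ j ∧ permToFun n σ (j+1) < permToFun n σ j) := by
  have inj : ∀ i < n, ∀ j < n, permToFun n σ i = permToFun n σ j → i = j := by
    intro i hi j hj h
    simp only [permToFun, hi, hj, dif_pos, Nat.add_right_cancel_iff] at h
    have := σ.injective (Fin.ext h)
    simpa using this
  have le : ∀ i < n, permToFun n σ i ≤ n := by
    intro i hi
    simp only [permToFun, hi, dif_pos]
    exact (σ ⟨i, hi⟩).2
  have surj : ∀ v, 1 ≤ v → v ≤ n → ∃ i < n, permToFun n σ i = v := by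
    intro v h1 h2
    refine ⟨σ.symm ⟨v-1, by omega⟩, Fin.is_lt _, ?_⟩
    simp [permToFun]; omega
  simp only [Finset.ext_iff, circularPeakSet, Finset.mem_image, Finset.mem_filter, Finset.mem_Ioo, Finset.mem_Icc]
  constructor
  · intro h j hj
    have := h (permToFun n σ j)
    constructor
    · intro h1
      obtain ⟨i, ⟨⟨i1, i2⟩, i3⟩, i4⟩ := this.2 ⟨h1, le j hj⟩
      obtain rfl := inj i (by omega) j hj i4
      exact ⟨i1, by omega, i3⟩
    · rintro ⟨h1, h2, h3⟩
      exact (this.1 ⟨j, ⟨⟨h1, by omega⟩, h3⟩, rfl⟩).1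
  · intro h v
    constructor
    · rintro ⟨j, ⟨⟨j1, j2⟩, j3⟩, rfl⟩
      exact ⟨(h j (by omega)).2 ⟨j1, by omega, j3⟩, le j (by omega)⟩
    · rintro ⟨h1, h2⟩
      obtain ⟨j, hj, rfl⟩ := surj v (by omega) h2
      obtain ⟨a, b, c⟩ := (h j hj).1 h1
      exact ⟨j, ⟨⟨a, by omega⟩, c⟩, rfl⟩

theorem cp_eq_s8 (n t : ℕ) (hn : 1 ≤ n) (ht : 1 ≤ t) :
    cp n (Finset.Icc t n) = (LL t (Finset.Icc 1 n)).card := by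
  rw [cp]
  have hg : ∀ σ : Equiv.Perm (Fin n), ∀ j, (List.ofFn (fun i => (σ i : ℕ) + 1)).getD j 0 = permToFun n σ j := by
    intro σ j
    by_cases h : j < n
    · rw [List.getD_eq_getElem _ _ (by simpa using h)]
      simp [permToFun, h]
    · rw [List.getD_eq_default _ _ (by simpa using h)]
      simp [permToFun, h]
  apply Finset.card_bij (fun σ _ => List.ofFn (fun i => (σ i : ℕ) + 1))
  · intro σ hσ
    rw [CPperms, Finset.mem_filter, cps_iff n t ht] at hσ
    rw [mem_LL]
    refine ⟨⟨?_, ?_⟩, ?_, ?_⟩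
    · rw [List.nodup_ofFn]
      intro a b h
      exact σ.injective (Fin.ext (by simpa using h))
    · ext v
      simp only [List.mem_toFinset, List.mem_ofFn, Finset.mem_Icc]
      constructor
      · rintro ⟨i, rfl⟩
        have := (σ i).2
        omega
      · rintro ⟨h1, h2⟩
        refine ⟨σ.symm ⟨v-1, by omega⟩, ?_⟩
        simp; omega
    · rw [← List.length_pos_iff]; simp; omega
    · intro j hj
      simp only [List.length_ofFn] at hj ⊢
      simp only [hg]
      exact hσ.2 j hj
  · intro σ _ τ _ h
    have := List.ofFn_injective h
    ext i
    have := congrFun this i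
    simpa using this
  · intro l hl
    rw [mem_LL] at hl
    obtain ⟨⟨h1, h2⟩, h3, h4⟩ := hl
    have hlen : l.length = n := by rw [← List.toFinset_card_of_nodup h1, h2]; simp
    have hmem : ∀ i : Fin n, 1 ≤ l[i.1]'(by omega) ∧ l[i.1]'(by omega) ≤ n := by
      intro i
      rw [← Finset.mem_Icc, ← h2, List.mem_toFinset]
      exact List.getElem_mem _
    let f : Fin n → Fin n := fun i => ⟨l[i.1]'(by omega) - 1, by have := hmem i; omega⟩
    have hf : Function.Injective f := by
      intro i j h
      simp only [f, Fin.mk.injEq] at h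
      have a := hmem i; have b := hmem j
      have : l[i.1]'(by omega) = l[j.1]'(by omega) := by omega
      exact Fin.ext ((h1.getElem_inj_iff).1 this)
    let σ : Equiv.Perm (Fin n) := Equiv.ofBijective f (Finite.injective_iff_bijective.1 hf)
    have e : List.ofFn (fun i => (σ i : ℕ) + 1) = l := by
      apply List.ext_getElem
      · simp [hlen]
      · intro i hi hi2
        have := hmem ⟨i, by omega⟩
        simp only [List.getElem_ofFn, σ, Equiv.ofBijective_apply, f]
        simp only at this
        omega
    refine ⟨σ, ?_, e⟩
    rw [CPperms, Finset.mem_filter, cps_iff n t ht]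
    refine ⟨Finset.mem_univ _, ?_⟩
    intro j hj
    have := h4 j (by omega)
    rw [← e] at this
    simp only [hg, List.length_ofFn] at this
    exact this

/-- Theorem 3.1: with `b_{1,1} = 1/2`,
`b_{k+1,1} = k(k+1)² Σ_{j=1}^k (-1)^{j+1} b_{k,j}` and
`b_{k+1,i} = k(k+1)·((k+2-i)/i)·b_{k,i-1}` for `2 ≤ i ≤ k+1`, one has, for every
`k ≥ 1` and `n ≥ max{3, 2k}` with `CP_n([n-k+1,n]) ≠ ∅`,
`cp_n([n-k+1,n]) = k(k+1) Σ_{i=1}^k (-1)^{i+1} b_{k,i} [(2k+2)^{n-2k} - (2k+2-2i)^{n-2k}]`. -/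
theorem cp_top_interval_formula_b (b : ℕ → ℕ → ℚ) (hb1 : b 1 1 = 1 / 2)
    (hbrec1 : ∀ k, 1 ≤ k →
      b (k + 1) 1 = (k : ℚ) * ((k : ℚ) + 1) ^ 2 *
        ∑ j ∈ Finset.Icc 1 k, (-1) ^ (j + 1) * b k j)
    (hbrec2 : ∀ k, 1 ≤ k → ∀ i, 2 ≤ i → i ≤ k + 1 →
      b (k + 1) i = (k : ℚ) * ((k : ℚ) + 1) * (((k : ℚ) + 2 - (i : ℚ)) / (i : ℚ)) *
        b k (i - 1)) :
    ∀ k, 1 ≤ k → ∀ n, max 3 (2 * k) ≤ n →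
      (CPperms n (Finset.Icc (n - k + 1) n)).Nonempty →
      (cp n (Finset.Icc (n - k + 1) n) : ℚ) =
        (k : ℚ) * ((k : ℚ) + 1) * ∑ i ∈ Finset.Icc 1 k, (-1) ^ (i + 1) * b k i *
          ((2 * (k : ℚ) + 2) ^ (n - 2 * k) - (2 * (k : ℚ) + 2 - 2 * (i : ℚ)) ^ (n - 2 * k)) := by
  intro k hk n hn _
  have hn1 : 3 ≤ n := le_trans (le_max_left _ _) hn
  have hn2 : 2 * k ≤ n := le_trans (le_max_right _ _) hn
  obtain ⟨d, rfl⟩ : ∃ d, n = 2 * k + d := ⟨n - 2 * k, by omega⟩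
  rw [cp_eq_s8 _ _ (by omega) (by omega), LL_card, Nat.add_sub_cancel_left,
    ← final_alg b k hk (b_closed b hb1 hbrec1 hbrec2 k hk) d]
  have e1 : (Finset.Icc 1 (2 * k + d)).filter (· < 2 * k + d - k + 1) = Finset.Icc 1 (k + d) := by
    ext x; simp only [Finset.mem_filter, Finset.mem_Icc]; omega
  have e2 : (Finset.Icc 1 (2 * k + d)).filter (2 * k + d - k + 1 ≤ ·) = Finset.Icc (k + d + 1) (2 * k + d) := by
    ext x; simp only [Finset.mem_filter, Finset.mem_Icc]; omega
  rw [e1, e2, Nat.card_Icc, Nat.card_Icc]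
  congr 1 <;> omega
end
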